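/- arXiv:2409.03442 — 7 statements merged into one kernel-verified Lean document; each statement's English description precedes it below -/
import Mathlib

section
/- Let k be a field of characteristic p > 0, let n ≥ 1, and let K = k(x₁, …, xₙ) be the rational function field in n variables over k. For any given elements f₁, …, fₙ ∈ K, there exists a nonzero element a ∈ K such that ∑_{i=1}^{n} ∂_{x_i}(a·f_i) = 0, where ∂_{x_i} denotes the partial derivative with respect to x_i (the unique k-derivation of K satisfying ∂_{x_i}(x_j) = δ_{ij}). -/
open MvPolynomial

noncomputable section

/-- The rational function field `k(x₁,…,xₙ)`, realized as the fraction field of the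
polynomial ring `k[x₁,…,xₙ]`. -/
abbrev RatFldN (k : Type) [Field k] (n : ℕ) : Type := FractionRing (MvPolynomial (Fin n) k)

/-- The image of the indeterminate `xᵢ` in `k(x₁,…,xₙ)`. -/
abbrev xKN (k : Type) [Field k] (n : ℕ) (i : Fin n) : RatFldN k n :=
  algebraMap (MvPolynomial (Fin n) k) (RatFldN k n) (X i)

namespace Derivation

variable {F L : Type*} [Field F] [Field L] [Algebra F L]

/-- The field of constants of a derivation of a field extension. -/
def constants (D : Derivation F L L) : IntermediateField F L where
  carrier := {a | D a = 0}
  mul_mem' {a b} ha hb := by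
    simp only [Set.mem_ofPred_eq] at ha hb ⊢
    simp [ha, hb]
  add_mem' {a b} ha hb := by
    simp only [Set.mem_ofPred_eq] at ha hb ⊢
    simp [ha, hb]
  algebraMap_mem' r := D.map_algebraMap r
  inv_mem' a ha := by
    simp only [Set.mem_ofPred_eq] at ha ⊢
    simp [leibniz_inv, ha]

theorem mem_constants {D : Derivation F L L} {a : L} : a ∈ D.constants ↔ D a = 0 := Iff.rfl

/-- A derivation is linear over its constants. -/
theorem map_mul_of_apply_eq_zero (D : Derivation F L L) {c : L} (hc : D c = 0) (a : L) :
    D (c * a) = c * D a := by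
  simp [hc]

theorem ad_pow_mulLeft (D : Derivation F L L) (a : L) (m : ℕ) :
    ((LinearMap.mulLeft F (D : Module.End F L) - LinearMap.mulRight F (D : Module.End F L)) ^ m)
      (LinearMap.mulLeft F a) = LinearMap.mulLeft F (((D : Module.End F L) ^ m) a) := by
  induction m with
  | zero => simp
  | succ m ih =>
    rw [pow_succ', Module.End.mul_apply, ih]
    ext b
    simp [pow_succ', mul_comm]

theorem apply_pow_char (p : ℕ) [CharP F p] (D : Derivation F L L) (a : L) :
    D (a ^ p) = 0 := by
  have : CharP L p := charP_of_injective_algebraMap (algebraMap F L).injective p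
  simp [leibniz_pow]

theorem pow_apply_pow_mul (D : Derivation F L L) {x c : L} (hx : D x = 1) (hc : D c = 0) (m : ℕ) :
    ((D : Module.End F L) ^ m) (x ^ m * c) = m.factorial * c := by
  induction m generalizing c with
  | zero => simp
  | succ m ih =>
    have h : D (x ^ (m + 1) * c) = x ^ m * (((m + 1 : ℕ) : L) * c) := by
      simp [leibniz_pow, hx, hc]
      ring
    rw [pow_succ, Module.End.mul_apply, coeFn_coe, h, ih (by simp [hc]), Nat.factorial_succ]
    push_cast
    ring

variable (p : ℕ) [Fact p.Prime] [CharP F p]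

/-- In characteristic `p`, the `p`-th iterate of a derivation is a derivation. -/
def powChar (D : Derivation F L L) : Derivation F L L :=
  Derivation.mk' ((D : Module.End F L) ^ p) fun a b => by
    have : CharP (Module.End F (Module.End F L)) p :=
      charP_of_injective_algebraMap (algebraMap F (Module.End F (Module.End F L))).injective p
    have h := ad_pow_mulLeft D a p
    have hsub : (LinearMap.mulLeft F (D : Module.End F L) -
        LinearMap.mulRight F (D : Module.End F L)) ^ p =
        LinearMap.mulLeft F (D : Module.End F L) ^ p -
          LinearMap.mulRight F (D : Module.End F L) ^ p :=
      sub_pow_char_of_commute (R := Module.End F (Module.End F L)) p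
        (LinearMap.commute_mulLeft_right _ _)
    rw [hsub, LinearMap.pow_mulLeft, LinearMap.pow_mulRight] at h
    have h' := LinearMap.congr_fun h b
    simp only [LinearMap.sub_apply, LinearMap.mulLeft_apply, LinearMap.mulRight_apply,
      Module.End.mul_apply] at h'
    rw [sub_eq_iff_eq_add] at h'
    rw [h', smul_eq_mul, smul_eq_mul]
    ring

theorem powChar_apply (D : Derivation F L L) (a : L) :
    D.powChar p a = ((D : Module.End F L) ^ p) a := rfl

end Derivation

section RationalFunctions

variable {k : Type} [Field k] {n : ℕ}

theorem eq_top_of_forall_xKN_mem (E : IntermediateField k (RatFldN k n))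
    (h : ∀ i, xKN k n i ∈ E) : E = ⊤ := by
  have hpoly (q : MvPolynomial (Fin n) k) : algebraMap _ (RatFldN k n) q ∈ E := by
    induction q using MvPolynomial.induction_on with
    | C r => exact E.algebraMap_mem r
    | add q r hq hr => rw [map_add]; exact add_mem hq hr
    | mul_X q i hq => rw [map_mul]; exact mul_mem hq (h i)
  rw [eq_top_iff]
  intro z _
  obtain ⟨q, r, -, rfl⟩ := IsFractionRing.div_surjective (A := MvPolynomial (Fin n) k) z
  exact div_mem (hpoly q) (hpoly r)

theorem derivation_eq_zero_of_forall_xKN {D : Derivation k (RatFldN k n) (RatFldN k n)}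
    (h : ∀ i, D (xKN k n i) = 0) : D = 0 := by
  ext a
  have ha : a ∈ D.constants := by
    rw [eq_top_of_forall_xKN_mem D.constants h]
    trivial
  exact ha

theorem finiteDimensional_of_xKN_pow_mem (E : IntermediateField k (RatFldN k n)) {m : ℕ}
    (hm : 0 < m) (h : ∀ i, xKN k n i ^ m ∈ E) : FiniteDimensional E (RatFldN k n) := by
  have hfin : FiniteDimensional E (IntermediateField.adjoin E (Set.range (xKN k n))) := by
    apply IntermediateField.finiteDimensional_adjoin
    rintro _ ⟨i, rfl⟩
    exact IsIntegral.of_pow hm (isIntegral_algebraMap (x := (⟨_, h i⟩ : E)))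
  have htop : IntermediateField.adjoin E (Set.range (xKN k n)) = ⊤ := by
    apply IntermediateField.restrictScalars_injective k
    rw [IntermediateField.restrictScalars_top]
    exact eq_top_of_forall_xKN_mem _ fun i => IntermediateField.subset_adjoin E _ ⟨i, rfl⟩
  rw [htop] at hfin
  exact IntermediateField.topEquiv.toLinearEquiv.finiteDimensional

variable {D : Fin n → Derivation k (RatFldN k n) (RatFldN k n)}

theorem commute_of_apply_xKN (hD : ∀ i j, D i (xKN k n j) = if i = j then 1 else 0) (i j : Fin n) :
    Commute (D i : Module.End k (RatFldN k n)) (D j : Module.End k (RatFldN k n)) := by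
  have h : ⁅D i, D j⁆ = 0 := derivation_eq_zero_of_forall_xKN fun l => by
    rw [Derivation.commutator_apply, hD, hD]
    split_ifs <;> simp
  ext a
  exact sub_eq_zero.1 ((Derivation.commutator_apply (D1 := D i) (D2 := D j) a).symm.trans
    (by rw [h, Derivation.zero_apply]))

theorem pow_char_eq_zero_of_apply_xKN (p : ℕ) [Fact p.Prime] [CharP k p]
    (hD : ∀ i j, D i (xKN k n j) = if i = j then 1 else 0) (i : Fin n) :
    (D i : Module.End k (RatFldN k n)) ^ p = 0 := by
  have h : (D i).powChar p = 0 := derivation_eq_zero_of_forall_xKN fun l => by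
    obtain ⟨m, hm⟩ := Nat.exists_eq_add_of_le' (Fact.out : p.Prime).two_le
    rw [Derivation.powChar_apply, hm, pow_add, Module.End.mul_apply, sq, Module.End.mul_apply,
      Derivation.coeFn_coe, hD]
    split_ifs <;> simp
  ext a
  exact Derivation.congr_fun h a

/-- The elements `∑ i, D i (g i)` do not exhaust the rational function field: all of them are killed
by the operator `∏ i, (D i) ^ (p - 1)`, which is nonzero. -/
theorem exists_ne_sum_apply (p : ℕ) [Fact p.Prime] [CharP k p]
    (hD : ∀ i j, D i (xKN k n j) = if i = j then 1 else 0) :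
    ∃ u : RatFldN k n, ∀ g : Fin n → RatFldN k n, ∑ i, D i (g i) ≠ u := by
  have hp : p.Prime := Fact.out
  have : CharP (RatFldN k n) p :=
    charP_of_injective_algebraMap (algebraMap k (RatFldN k n)).injective p
  let P (i : Fin n) : Module.End k (RatFldN k n) := (D i : Module.End k (RatFldN k n)) ^ (p - 1)
  have hP (s : Finset (Fin n)) : (s : Set (Fin n)).Pairwise (Function.onFun Commute P) :=
    fun i _ j _ _ => (commute_of_apply_xKN hD i j).pow_pow _ _
  have hkill (i : Fin n) (a : RatFldN k n) :
      (Finset.univ.noncommProd P (hP _)) (D i a) = 0 := by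
    have hz : Finset.univ.noncommProd P (hP _) * (D i : Module.End k (RatFldN k n)) = 0 := by
      rw [← Finset.noncommProd_erase_mul _ (Finset.mem_univ i), mul_assoc, ← pow_succ,
        Nat.sub_add_cancel hp.one_le, pow_char_eq_zero_of_apply_xKN p hD, mul_zero]
    exact LinearMap.congr_fun hz a
  have hne (s : Finset (Fin n)) :
      (s.noncommProd P (hP s)) (∏ i ∈ s, xKN k n i ^ (p - 1)) =
        ((p - 1).factorial : RatFldN k n) ^ s.card := by
    induction s using Finset.induction_on with
    | empty => simp
    | insert i s hi ih =>
      have hc : D i (∏ j ∈ s, xKN k n j ^ (p - 1)) = 0 :=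
        Derivation.mem_constants.1 <| prod_mem fun j hj => pow_mem (Derivation.mem_constants.2 <| by
          rw [hD]
          refine if_neg ?_
          rintro rfl
          exact hi hj) _
      rw [Finset.noncommProd_insert_of_notMem' _ _ _ _ hi, Finset.prod_insert hi,
        Module.End.mul_apply, Derivation.pow_apply_pow_mul _ (by rw [hD, if_pos rfl]) hc,
        ← nsmul_eq_mul, map_nsmul, ih, nsmul_eq_mul, Finset.card_insert_of_notMem hi, pow_succ']
  refine ⟨∏ i, xKN k n i ^ (p - 1), fun g hg => ?_⟩
  have h := hne Finset.univ
  rw [← hg, map_sum, Finset.sum_eq_zero fun i _ => hkill i _] at h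
  have hfac : ((p - 1).factorial : RatFldN k n) ≠ 0 := by
    rw [Ne, CharP.cast_eq_zero_iff _ p, hp.dvd_factorial]
    have := hp.pos
    omega
  exact pow_ne_zero _ hfac h.symm

end RationalFunctions

/-- Lemma 1 of the paper: for `f₁,…,fₙ ∈ K = k(x₁,…,xₙ)` there is a nonzero `a ∈ K` with
`∑ᵢ ∂_{xᵢ}(a·fᵢ) = 0`, where `∂_{xᵢ}` is the unique `k`-derivation of `K` with
`∂_{xᵢ}(xⱼ) = δᵢⱼ`. -/
theorem exists_multiplier_sum_pderiv_eq_zero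
    (p : ℕ) (hp : p.Prime) (k : Type) [Field k] [CharP k p]
    (n : ℕ) (hn : 1 ≤ n)
    (D : Fin n → Derivation k (RatFldN k n) (RatFldN k n))
    (hD : ∀ i j, D i (xKN k n j) = if i = j then 1 else 0)
    (f : Fin n → RatFldN k n) :
    ∃ a : RatFldN k n, a ≠ 0 ∧ ∑ i, D i (a * f i) = 0 := by
  have : Fact p.Prime := ⟨hp⟩
  let E : IntermediateField k (RatFldN k n) := ⨅ i, (D i).constants
  have hE (c : E) (i : Fin n) : D i c = 0 := (iInf_le (fun i => (D i).constants) i) c.2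
  have : FiniteDimensional E (RatFldN k n) := finiteDimensional_of_xKN_pow_mem E hp.pos fun j => by
    rw [← SetLike.mem_coe, IntermediateField.coe_iInf]
    exact Set.mem_iInter.2 fun i => (D i).apply_pow_char p _
  let T : RatFldN k n →ₗ[E] RatFldN k n :=
    { toFun a := ∑ i, D i (a * f i)
      map_add' a b := by simp only [add_mul, map_add, Finset.sum_add_distrib]
      map_smul' c a := by
        simp only [IntermediateField.smul_def, smul_eq_mul, RingHom.id_apply, mul_assoc,
          Finset.mul_sum]
        exact Finset.sum_congr rfl fun i _ => (D i).map_mul_of_apply_eq_zero (hE c i) _ }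
  obtain ⟨u, hu⟩ := exists_ne_sum_apply p hD
  have hT : ¬ Function.Injective T := fun h => by
    obtain ⟨a, ha⟩ := LinearMap.injective_iff_surjective.1 h u
    exact hu (fun i => a * f i) ha
  rw [injective_iff_map_eq_zero] at hT
  push Not at hT
  obtain ⟨a, ha, ha0⟩ := hT
  exact ⟨a, ha0, ha⟩
end
end

section
/- Let k be a field of characteristic p > 0 and R = k[x,y] the polynomial ring in two variables. Let f, g, a ∈ R and suppose that ∂_x(a·f) + ∂_y(a·g) = 0. Let ∂ = f·∂_x + g·∂_y be the corresponding k-derivation of R, and let ∂^p denote its p-fold iterate. Then a·(f·∂^p(y) − g·∂^p(x)) = f^p·∂_x^{p−1}(a·g) − g^p·∂_y^{p−1}(a·f), where ∂_x^{p−1} and ∂_y^{p−1} denote the (p−1)-fold iterates of the partial derivatives. -/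
open MvPolynomial

noncomputable section

/-- The partial derivative `∂_x` on `R = k[x,y]`, as a `k`-derivation. -/
abbrev Px (k : Type) [Field k] :
    Derivation k (MvPolynomial (Fin 2) k) (MvPolynomial (Fin 2) k) := pderiv 0

/-- The partial derivative `∂_y` on `R = k[x,y]`, as a `k`-derivation. -/
abbrev Py (k : Type) [Field k] :
    Derivation k (MvPolynomial (Fin 2) k) (MvPolynomial (Fin 2) k) := pderiv 1

section Derivations

variable {k R : Type*} [Field k] [CommRing R] [Algebra k R]

/-- The general Leibniz rule for iterates of a derivation. -/
theorem Derivation.iterate_mul (D : Derivation k R R) (n : ℕ) (a b : R) :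
    D^[n] (a * b) =
      ∑ ij ∈ Finset.HasAntidiagonal.antidiagonal n, n.choose ij.1 • (D^[ij.1] a * D^[ij.2] b) := by
  induction n with
  | zero => simp
  | succ n ih =>
    rw [Finset.sum_antidiagonal_choose_succ_nsmul (M := R) (fun i j => D^[i] a * D^[j] b) n]
    simp only [Function.iterate_succ_apply', ih, map_sum, map_nsmul, Derivation.leibniz,
      smul_eq_mul, smul_add, Finset.sum_add_distrib]
    congr 1
    refine Finset.sum_congr rfl fun ij hij => ?_
    rw [Finset.HasAntidiagonal.mem_antidiagonal] at hij
    rw [mul_comm, Nat.choose_symm_of_eq_add hij.symm]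

theorem Derivation.iterate_char_mul (p : ℕ) (hp : p.Prime) [CharP R p] (D : Derivation k R R)
    (a b : R) : D^[p] (a * b) = a * D^[p] b + b * D^[p] a := by
  rw [D.iterate_mul, Finset.sum_eq_add_of_mem (0, p) (p, 0)]
  · simp [mul_comm]
  · simp
  · simp
  · simp [hp.ne_zero.symm]
  · rintro ⟨i, j⟩ hij ⟨h₁, h₂⟩
    rw [Finset.HasAntidiagonal.mem_antidiagonal] at hij
    simp only [ne_eq, Prod.mk.injEq, not_and] at h₁ h₂ hij
    rw [nsmul_eq_mul, (CharP.cast_eq_zero_iff R p _).2 (hp.dvd_choose_self ?_ ?_), zero_mul]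
    · rintro rfl
      omega
    · by_contra h
      omega

/-- In characteristic `p`, the `p`-fold iterate of a derivation is a derivation. -/
def Derivation.iterateChar (p : ℕ) (hp : p.Prime) [CharP R p] (D : Derivation k R R) :
    Derivation k R R :=
  Derivation.mk' (D.toLinearMap ^ p) fun a b => by
    simpa [Module.End.pow_apply] using D.iterate_char_mul p hp a b

theorem Derivation.iterateChar_apply (p : ℕ) (hp : p.Prime) [CharP R p] (D : Derivation k R R)
    (a : R) : D.iterateChar p hp a = D^[p] a := by
  simp [Derivation.iterateChar, Module.End.pow_apply]

theorem Derivation.iterate_mul_of_apply_eq_zero (D : Derivation k R R) {c : R} (hc : D c = 0)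
    (n : ℕ) (a : R) : D^[n] (c * a) = c * D^[n] a := by
  induction n with
  | zero => rfl
  | succ n ih => simp [Function.iterate_succ_apply', ih, hc]

theorem Derivation.iterate_add (D : Derivation k R R) (n : ℕ) (a b : R) :
    D^[n] (a + b) = D^[n] a + D^[n] b := by
  simp

theorem Derivation.iterate_sub (D : Derivation k R R) (n : ℕ) (a b : R) :
    D^[n] (a - b) = D^[n] a - D^[n] b := by
  simp

theorem Derivation.iterate_zero (D : Derivation k R R) (n : ℕ) : D^[n] (0 : R) = 0 := by
  simp

/-- The terms of degree less than `p` of `exp (tD) a`. -/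
def truncatedExp (p : ℕ) (D : Derivation k R R) (a : R) : Polynomial R :=
  ∑ n ∈ Finset.range p, Polynomial.monomial n ((n.factorial : k)⁻¹ • D^[n] a)

theorem coeff_truncatedExp (p : ℕ) (D : Derivation k R R) (a : R) (n : ℕ) :
    (truncatedExp p D a).coeff n = if n < p then (n.factorial : k)⁻¹ • D^[n] a else 0 := by
  simp [truncatedExp, Polynomial.finsetSum_coeff, Polynomial.coeff_monomial]

theorem factorial_cast_ne_zero (p : ℕ) (hp : p.Prime) [CharP k p] {n : ℕ} (hn : n < p) :
    (n.factorial : k) ≠ 0 := by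
  rw [Ne, CharP.cast_eq_zero_iff k p, hp.dvd_factorial]
  omega

theorem coeff_truncatedExp_mul (p : ℕ) (hp : p.Prime) [CharP k p] (D : Derivation k R R)
    (a b : R) {n : ℕ} (hn : n < p) :
    (truncatedExp p D a * truncatedExp p D b).coeff n = (truncatedExp p D (a * b)).coeff n := by
  rw [Polynomial.coeff_mul, coeff_truncatedExp, if_pos hn, D.iterate_mul, Finset.smul_sum]
  refine Finset.sum_congr rfl fun ij hij => ?_
  rw [Finset.HasAntidiagonal.mem_antidiagonal] at hij
  rw [coeff_truncatedExp, coeff_truncatedExp, if_pos (by omega), if_pos (by omega),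
    smul_mul_smul_comm, ← Nat.cast_smul_eq_nsmul k, smul_smul]
  congr 1
  have h1 := factorial_cast_ne_zero (k := k) p hp hn
  have h2 := factorial_cast_ne_zero (k := k) p hp (n := ij.1) (by omega)
  have h3 := factorial_cast_ne_zero (k := k) p hp (n := ij.2) (by omega)
  have h4 : (n.choose ij.1 : k) * ij.1.factorial * ij.2.factorial = n.factorial := by
    have h := Nat.add_choose_mul_factorial_mul_factorial ij.2 ij.1
    rw [add_comm, hij, mul_right_comm] at h
    exact_mod_cast congrArg (Nat.cast (R := k)) h
  field_simp
  linear_combination -h4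

theorem coeff_truncatedExp_pow_mul (p : ℕ) (hp : p.Prime) [CharP k p] (D : Derivation k R R)
    (a b : R) (m : ℕ) {n : ℕ} (hn : n < p) :
    (truncatedExp p D a ^ m * truncatedExp p D b).coeff n =
      (truncatedExp p D (a ^ m * b)).coeff n := by
  induction m generalizing n with
  | zero => simp
  | succ m ih =>
    rw [pow_succ', pow_succ', mul_assoc, mul_assoc, ← coeff_truncatedExp_mul p hp D _ _ hn,
      Polynomial.coeff_mul, Polynomial.coeff_mul]
    refine Finset.sum_congr rfl fun ij hij => ?_
    rw [Finset.HasAntidiagonal.mem_antidiagonal] at hij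
    rw [ih (by omega)]

end Derivations

theorem Polynomial.coeff_pow_mul_derivative {R : Type*} [CommRing R] (n : ℕ) (A : Polynomial R) :
    (A ^ n * derivative A).coeff n = (A ^ (n + 1)).coeff (n + 1) := by
  have torsionFree (B : Polynomial (MvPolynomial R ℤ)) :
      (B ^ n * derivative B).coeff n = (B ^ (n + 1)).coeff (n + 1) := by
    have h := congrArg (fun P => P.coeff n) (derivative_pow_succ B n)
    simp only [coeff_derivative, mul_assoc, coeff_C_mul] at h
    have h0 : ((n : MvPolynomial R ℤ) + 1) ≠ 0 := by exact_mod_cast n.succ_ne_zero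
    refine mul_left_cancel₀ h0 ?_
    rw [← h, mul_comm]
  obtain ⟨B, rfl⟩ := Polynomial.map_surjective
    (MvPolynomial.eval₂Hom (Int.castRingHom R) (id : R → R))
    (fun r => ⟨MvPolynomial.X r, by simp⟩) A
  rw [derivative_map, ← Polynomial.map_pow, ← Polynomial.map_mul, ← Polynomial.map_pow,
    coeff_map, coeff_map, torsionFree]

theorem Polynomial.coeff_pow_char {R : Type*} [CommRing R] (p : ℕ) (hp : p.Prime) [CharP R p]
    (A : Polynomial R) : (A ^ p).coeff p = A.coeff 1 ^ p := by
  have := Fact.mk hp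
  rw [← map_frobenius_expand p A, coeff_map, coeff_expand hp.pos]
  simp [hp.pos, frobenius_def]

theorem factorial_pred_cast (k : Type*) [Field k] (p : ℕ) (hp : p.Prime) [CharP k p] :
    ((p - 1).factorial : k) = -1 := by
  have := Fact.mk hp
  have h := congrArg (ZMod.castHom dvd_rfl k) (ZMod.wilsons_lemma p)
  rwa [map_natCast, map_neg, map_one] at h

section Derivations

variable {k R : Type*} [Field k] [CommRing R] [Algebra k R]

theorem truncatedExp_apply (p : ℕ) (hp : p.Prime) [CharP k p] (D : Derivation k R R) (x : R) :
    truncatedExp p D (D x) = Polynomial.derivative (truncatedExp p D x) -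
      Polynomial.monomial (p - 1) (D^[p] x) := by
  ext n
  rw [Polynomial.coeff_sub, Polynomial.coeff_derivative, coeff_truncatedExp, coeff_truncatedExp,
    Polynomial.coeff_monomial, ← Function.iterate_succ_apply]
  have hp0 := hp.pos
  rcases lt_trichotomy (n + 1) p with h | h | h
  · rw [if_pos (by omega), if_pos h, if_neg (by omega), sub_zero, mul_comm]
    have h1 := factorial_cast_ne_zero (k := k) p hp h
    have h2 : ((n + 1 : ℕ) : R) = algebraMap k R (n + 1 : ℕ) := by simp
    rw [← Nat.cast_succ, h2, ← Algebra.smul_def, smul_smul]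
    congr 1
    rw [Nat.factorial_succ, Nat.cast_mul] at h1 ⊢
    rw [mul_inv, mul_inv_cancel_left₀ (left_ne_zero_of_mul h1)]
  · subst h
    have := factorial_pred_cast k (n + 1) hp
    simp only [Nat.add_sub_cancel] at this
    simp [this]
  · rw [if_neg (by omega), if_neg (by omega), if_neg (by omega)]
    simp

/-- Katz's identity, the logarithmic form of which is
`D^[p] x / x = D^[p - 1] (D x / x) + (D x / x) ^ p`. -/
theorem Derivation.iterate_pred_pow_pred_mul (p : ℕ) (hp : p.Prime) [CharP k p] [CharP R p]
    (D : Derivation k R R) (x : R) :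
    D^[p - 1] (x ^ (p - 1) * D x) = x ^ (p - 1) * D^[p] x - D x ^ p := by
  have hp1 : p - 1 < p := Nat.sub_lt hp.pos one_pos
  have key := coeff_truncatedExp_pow_mul p hp D x (D x) (p - 1) hp1
  rw [coeff_truncatedExp, if_pos hp1, factorial_pred_cast k p hp, truncatedExp_apply p hp,
    mul_sub, Polynomial.coeff_sub, Polynomial.coeff_pow_mul_derivative,
    Nat.sub_add_cancel hp.one_le, Polynomial.coeff_pow_char p hp, coeff_truncatedExp,
    if_pos hp.one_lt] at key
  have h0 : (truncatedExp p D x ^ (p - 1) * Polynomial.monomial (p - 1) (D^[p] x)).coeff (p - 1)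
      = x ^ (p - 1) * D^[p] x := by
    have h := Polynomial.coeff_mul_monomial (truncatedExp p D x ^ (p - 1)) (p - 1) 0 (D^[p] x)
    rw [zero_add] at h
    rw [h, Polynomial.coeff_zero_eq_eval_zero, Polynomial.eval_pow,
      ← Polynomial.coeff_zero_eq_eval_zero, coeff_truncatedExp, if_pos hp.pos]
    simp
  rw [h0] at key
  simp only [Nat.factorial_one, Nat.cast_one, inv_one, one_smul, Function.iterate_one,
    inv_neg, neg_smul] at key
  linear_combination key

/-- The partial sums of the antiderivative of `u` obtained by repeated integration by parts. -/
def partialIntegral (D : Derivation k R R) (x u : R) (n : ℕ) : R :=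
  ∑ i ∈ Finset.range n, ((-1) ^ i * ((i + 1).factorial : k)⁻¹) • (x ^ (i + 1) * D^[i] u)

theorem Derivation.apply_partialIntegral (p : ℕ) (hp : p.Prime) [CharP k p]
    (D : Derivation k R R) {x : R} (hx : D x = 1) (u : R) {n : ℕ} (hn : n < p) :
    D (partialIntegral D x u n) = u - ((-1) ^ n * (n.factorial : k)⁻¹) • (x ^ n * D^[n] u) := by
  induction n with
  | zero => simp [partialIntegral]
  | succ n ih =>
    have h1 := factorial_cast_ne_zero (k := k) p hp hn
    rw [Nat.factorial_succ, Nat.cast_mul] at h1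
    rw [partialIntegral, Finset.sum_range_succ, ← partialIntegral, map_add, ih (by omega),
      Derivation.map_smul, Derivation.leibniz, Derivation.leibniz_pow, hx,
      ← Function.iterate_succ_apply' D]
    have h2 : ((n.factorial : k)⁻¹) = (n + 1 : ℕ) * ((n + 1).factorial : k)⁻¹ := by
      rw [Nat.factorial_succ, Nat.cast_mul, mul_inv,
        mul_inv_cancel_left₀ (left_ne_zero_of_mul h1)]
    rw [h2]
    simp only [smul_eq_mul, nsmul_eq_mul, Nat.add_sub_cancel, Algebra.smul_def (R := k), map_mul,
      _root_.map_natCast, map_pow, map_neg, map_one, Nat.succ_eq_add_one]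
    ring

theorem Derivation.apply_partialIntegral_pred (p : ℕ) (hp : p.Prime) [CharP k p]
    (D : Derivation k R R) {x : R} (hx : D x = 1) (u : R) :
    D (partialIntegral D x u (p - 1)) = u + x ^ (p - 1) * D^[p - 1] u := by
  have := Fact.mk hp
  have h : (-1 : k) ^ (p - 1) = 1 := by
    have h := congrArg (ZMod.castHom dvd_rfl k)
      (ZMod.pow_card_sub_one_eq_one (p := p) (neg_ne_zero.2 one_ne_zero))
    rwa [map_pow, map_neg, map_one] at h
  rw [D.apply_partialIntegral p hp hx u (Nat.sub_lt hp.pos one_pos), factorial_pred_cast k p hp, h]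
  simp

theorem Derivation.partialIntegral_eq_zero (D E : Derivation k R R)
    (hDE : Function.Commute D E) {x u : R} (hx : E x = 0) (hu : E u = 0) (n : ℕ) :
    E (partialIntegral D x u n) = 0 := by
  have h (i : ℕ) : E (D^[i] u) = 0 := by
    rw [← (hDE.iterate_left i) u, hu, D.iterate_zero]
  simp [partialIntegral, Derivation.leibniz_pow, hx, h]

end Derivations

section Plane

variable {k : Type*} [Field k]

local notation "R₂" => MvPolynomial (Fin 2) k

theorem MvPolynomial.pderiv_commute {σ : Type*} (i j : σ) :
    Function.Commute (pderiv i : Derivation k (MvPolynomial σ k) (MvPolynomial σ k))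
      (pderiv j : Derivation k (MvPolynomial σ k) (MvPolynomial σ k)) := by
  classical
  have h : ⁅(pderiv i : Derivation k (MvPolynomial σ k) (MvPolynomial σ k)),
      (pderiv j : Derivation k (MvPolynomial σ k) (MvPolynomial σ k))⁆ = 0 := by
    refine derivation_ext fun l => ?_
    rw [Derivation.commutator_apply]
    simp [pderiv_X, Pi.single_apply, apply_ite]
  intro a
  have := DFunLike.congr_fun h a
  simpa [Derivation.commutator_apply, sub_eq_zero] using this

theorem MvPolynomial.iterate_char_pderiv {σ : Type*} (p : ℕ) (hp : p.Prime) [CharP k p] (i : σ)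
    (a : MvPolynomial σ k) : (⇑(pderiv i : Derivation k (MvPolynomial σ k) (MvPolynomial σ k)))^[p] a = 0 := by
  classical
  rw [← Derivation.iterateChar_apply p hp]
  suffices h : Derivation.iterateChar p hp (pderiv i : Derivation k (MvPolynomial σ k) (MvPolynomial σ k)) = 0 by
    simp [h]
  refine derivation_ext fun l => ?_
  obtain ⟨n, rfl⟩ : ∃ n, p = n + 1 + 1 := ⟨p - 2, by have := hp.two_le; omega⟩
  rw [Derivation.iterateChar_apply, Function.iterate_succ_apply, Function.iterate_succ_apply]
  rw [show pderiv i (pderiv i (X l : MvPolynomial σ k)) = 0 by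
    rw [pderiv_X, Pi.single_apply]; split_ifs <;> simp]
  simp

theorem MvPolynomial.derivation_apply_fin_two (D : Derivation k R₂ R₂) (h : R₂) :
    D h = pderiv 0 h * D (X 0) + pderiv 1 h * D (X 1) := by
  have e : D = D (X 0) • pderiv 0 + D (X 1) • pderiv 1 := by
    refine derivation_ext fun i => ?_
    fin_cases i <;> simp [pderiv_X]
  conv_lhs => rw [e]
  simp [mul_comm]

/-- Cartier's description of closed differential forms `u dx + v dy` on the plane. -/
theorem MvPolynomial.exists_pderiv_eq_add (p : ℕ) (hp : p.Prime) [CharP k p] {u v : R₂}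
    (huv : pderiv 1 u = pderiv 0 v) :
    ∃ h : R₂, pderiv 0 h = u + X 0 ^ (p - 1) * (⇑(pderiv (R := k) (0 : Fin 2)))^[p - 1] u ∧
      pderiv 1 h = v + X 1 ^ (p - 1) * (⇑(pderiv (R := k) (1 : Fin 2)))^[p - 1] v := by
  have hpp : p = p - 1 + 1 := (Nat.sub_add_cancel hp.one_le).symm
  have comm := pderiv_commute (k := k) (0 : Fin 2) 1
  set Dx : Derivation k R₂ R₂ := pderiv 0
  set Dy : Derivation k R₂ R₂ := pderiv 1
  set h₁ := partialIntegral Dx (X 0) u (p - 1)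
  have hx1 : Dx h₁ = u + X 0 ^ (p - 1) * Dx^[p - 1] u :=
    Dx.apply_partialIntegral_pred p hp (pderiv_X_self 0) u
  have hX : Dy (X 0) = 0 := pderiv_X_of_ne (by decide)
  have hY : Dx (X 1) = 0 := pderiv_X_of_ne (by decide)
  have hv1 : Dx (v - Dy h₁) = 0 := by
    rw [map_sub, comm h₁, hx1, map_add, Derivation.leibniz, Derivation.leibniz_pow, hX,
      ← (comm.iterate_left (p - 1)) u, huv, ← Function.iterate_succ_apply, Nat.succ_eq_add_one,
      ← hpp, iterate_char_pderiv p hp]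
    simp
  refine ⟨h₁ + partialIntegral Dy (X 1) (v - Dy h₁) (p - 1), ?_, ?_⟩
  · rw [map_add, Derivation.partialIntegral_eq_zero Dy Dx comm.symm hY hv1, hx1, add_zero]
  · rw [map_add, Dy.apply_partialIntegral_pred p hp (pderiv_X_self 1), Derivation.iterate_sub,
      ← Function.iterate_succ_apply, Nat.succ_eq_add_one, ← hpp, iterate_char_pderiv p hp]
    ring

/-- Katz's formula for the `p`-th iterate of a derivation annihilating a closed form
`u dx + v dy` on the plane. -/
theorem MvPolynomial.iterate_char_of_closed (p : ℕ) (hp : p.Prime) [CharP k p]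
    (D : Derivation k R₂ R₂) {u v : R₂} (huv : pderiv 1 u = pderiv 0 v)
    (hD : u * D (X 0) + v * D (X 1) = 0) :
    u * D^[p] (X 0) + v * D^[p] (X 1) =
      -(D (X 0) ^ p * (⇑(pderiv (R := k) (0 : Fin 2)))^[p - 1] u
        + D (X 1) ^ p * (⇑(pderiv (R := k) (1 : Fin 2)))^[p - 1] v) := by
  have hpp : p = p - 1 + 1 := (Nat.sub_add_cancel hp.one_le).symm
  have hppx (i : Fin 2) (a : R₂) :
      pderiv i ((⇑(pderiv (R := k) i))^[p - 1] a) = 0 := by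
    rw [← Function.iterate_succ_apply' (pderiv i), Nat.succ_eq_add_one, ← hpp,
      iterate_char_pderiv p hp]
  have comm := pderiv_commute (k := k) (0 : Fin 2) 1
  obtain ⟨h, hx, hy⟩ := exists_pderiv_eq_add p hp huv
  set c := (⇑(pderiv (R := k) (0 : Fin 2)))^[p - 1] u with hc
  set d := (⇑(pderiv (R := k) (1 : Fin 2)))^[p - 1] v with hd
  have hDc : D c = 0 := by
    have hyc : pderiv 1 c = 0 := by
      rw [hc, ← (comm.iterate_left (p - 1)) u, huv, ← Function.iterate_succ_apply,
        Function.iterate_succ_apply', hppx]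
    rw [derivation_apply_fin_two, hyc, hppx]
    simp
  have hDd : D d = 0 := by
    have hxd : pderiv 0 d = 0 := by
      rw [hd, ← (comm.symm.iterate_left (p - 1)) v, ← huv, ← Function.iterate_succ_apply,
        Function.iterate_succ_apply', hppx]
    rw [derivation_apply_fin_two, hxd, hppx]
    simp
  have hDh : D h = c * (X 0 ^ (p - 1) * D (X 0)) + d * (X 1 ^ (p - 1) * D (X 1)) := by
    rw [derivation_apply_fin_two, hx, hy]
    linear_combination hD
  have hDp := derivation_apply_fin_two (D.iterateChar p hp) h
  have hit : D^[p] h = D^[p - 1] (D h) := by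
    rw [← Function.iterate_succ_apply, Nat.succ_eq_add_one, ← hpp]
  simp only [Derivation.iterateChar_apply] at hDp
  rw [hit, hDh, D.iterate_add, D.iterate_mul_of_apply_eq_zero hDc,
    D.iterate_mul_of_apply_eq_zero hDd, D.iterate_pred_pow_pred_mul p hp,
    D.iterate_pred_pow_pred_mul p hp, hx, hy] at hDp
  linear_combination -hDp

end Plane

/-- Polynomial-ring version of Theorem 2 of the paper: in `R = k[x,y]` with
`∂ = f·∂_x + g·∂_y` and `a ∈ R` satisfying `∂_x(a·f) + ∂_y(a·g) = 0`, one has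
`a·(f·∂^p(y) − g·∂^p(x)) = f^p·∂_x^{p−1}(a·g) − g^p·∂_y^{p−1}(a·f)`. -/
theorem key_identity_polynomial_ring
    (p : ℕ) (hp : p.Prime) (k : Type) [Field k] [CharP k p]
    (f g a : MvPolynomial (Fin 2) k)
    (hdiv : Px k (a * f) + Py k (a * g) = 0) :
    a * (f * (⇑(f • Px k + g • Py k))^[p] (X 1)
          - g * (⇑(f • Px k + g • Py k))^[p] (X 0))
      = f ^ p * (⇑(Px k))^[p - 1] (a * g)
          - g ^ p * (⇑(Py k))^[p - 1] (a * f) := by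
  have huv : pderiv 1 (-(a * g)) = pderiv 0 (a * f) := by
    rw [map_neg]
    linear_combination -hdiv
  have key := iterate_char_of_closed p hp (f • Px k + g • Py k) huv
    (by simp [pderiv_X]; ring)
  have hneg : (⇑(Px k))^[p - 1] (-(a * g)) = -(⇑(Px k))^[p - 1] (a * g) := by
    rw [← zero_sub, Derivation.iterate_sub, Derivation.iterate_zero, zero_sub]
  have hX : (f • Px k + g • Py k) (X 0) = f := by simp [pderiv_X]
  have hY : (f • Px k + g • Py k) (X 1) = g := by simp [pderiv_X]
  rw [hX, hY, hneg] at key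
  linear_combination key
end
end

section
/- Let k be a field of characteristic p > 0 and K = k(x,y) the rational function field in two variables. Let f, g ∈ K and let a ∈ K be nonzero with ∂_x(a·f) + ∂_y(a·g) = 0. Let ∂ = f·∂_x + g·∂_y be the corresponding k-derivation of K. Then a·(∂(x)·∂^p(y) − ∂(y)·∂^p(x)) = f^p·∂_x^{p−1}(a·g) − g^p·∂_y^{p−1}(a·f), where ∂^p denotes the p-fold iterate of ∂ and ∂_x^{p−1}, ∂_y^{p−1} the (p−1)-fold iterates of the partial derivatives. -/
open MvPolynomial

noncomputable section

/-- The rational function field `k(x,y)`, realized as the fraction field of `k[x,y]`. -/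
abbrev RatFld2 (k : Type) [Field k] : Type := FractionRing (MvPolynomial (Fin 2) k)

/-- The image of the indeterminate `x` in `k(x,y)`. -/
abbrev xK (k : Type) [Field k] : RatFld2 k :=
  algebraMap (MvPolynomial (Fin 2) k) (RatFld2 k) (X 0)

/-- The image of the indeterminate `y` in `k(x,y)`. -/
abbrev yK (k : Type) [Field k] : RatFld2 k :=
  algebraMap (MvPolynomial (Fin 2) k) (RatFld2 k) (X 1)

namespace Derivation

section CommRing

variable {R A : Type*} [CommRing R] [CommRing A] [Algebra R A]

theorem iterate_mul_s3 (D : Derivation R A A) (n : ℕ) (a b : A) :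
    D^[n] (a * b) =
      ∑ ij ∈ Finset.HasAntidiagonal.antidiagonal n, (n.choose ij.1 : A) * (D^[ij.1] a * D^[ij.2] b) := by
  induction n with
  | zero => simp
  | succ n ih =>
    rw [Finset.sum_antidiagonal_choose_succ_mul (fun i j => D^[i] a * D^[j] b) n,
      Function.iterate_succ_apply', ih, map_sum, ← Finset.sum_add_distrib]
    refine Finset.sum_congr rfl fun ij hij => ?_
    rw [Nat.choose_symm_of_eq_add (Finset.HasAntidiagonal.mem_antidiagonal.mp hij).symm]
    simp only [leibniz, smul_eq_mul, map_natCast, Function.iterate_succ_apply', mul_zero, add_zero]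
    ring

theorem iterate_char_mul_s3 (p : ℕ) [Fact p.Prime] [CharP A p] (D : Derivation R A A) (a b : A) :
    D^[p] (a * b) = a * D^[p] b + b * D^[p] a := by
  have hp : p.Prime := Fact.out
  rw [iterate_mul_s3, Finset.Nat.sum_antidiagonal_eq_sum_range_succ
    (fun i j => (p.choose i : A) * (D^[i] a * D^[j] b)), Finset.sum_range_succ,
    Finset.sum_eq_single 0]
  · simp [mul_comm]
  · intro i hi hi0
    rw [(CharP.cast_eq_zero_iff A p _).mpr
      (hp.dvd_choose_self hi0 (Finset.mem_range.mp hi)), zero_mul]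
  · intro h
    exact absurd (Finset.mem_range.mpr hp.pos) h

/-- In characteristic `p`, the `p`-fold iterate of a derivation is a derivation. -/
def iterateChar_s3 (p : ℕ) [Fact p.Prime] [CharP A p] (D : Derivation R A A) : Derivation R A A :=
  Derivation.mk' ((D : A →ₗ[R] A) ^ p) fun a b => by
    simpa [Module.End.pow_apply] using iterate_char_mul_s3 p D a b

theorem iterateChar_apply_s3 (p : ℕ) [Fact p.Prime] [CharP A p] (D : Derivation R A A) (a : A) :
    iterateChar_s3 p D a = D^[p] a := by
  simp [iterateChar_s3, Module.End.pow_apply]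

theorem iterate_const_mul (D : Derivation R A A) {c : A} (hc : D c = 0) (n : ℕ) (a : A) :
    D^[n] (c * a) = c * D^[n] a := by
  induction n with
  | zero => rfl
  | succ n ih => simp [Function.iterate_succ_apply', ih, hc]

/-- The derivation of `A[t]` which applies `D` to each coefficient. -/
def coeffwise (D : Derivation R A A) : Derivation R (Polynomial A) (Polynomial A) :=
  PolynomialModule.equivPolynomialSelf.toLinearMap.compDer D.mapCoeffs

theorem coeff_coeffwise (D : Derivation R A A) (q : Polynomial A) (n : ℕ) :
    (D.coeffwise q).coeff n = D (q.coeff n) :=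
  rfl

theorem coeffwise_monomial (D : Derivation R A A) (n : ℕ) (a : A) :
    D.coeffwise (Polynomial.monomial n a) = Polynomial.monomial n (D a) := by
  ext m
  rw [coeff_coeffwise, Polynomial.coeff_monomial, Polynomial.coeff_monomial, apply_ite D, map_zero]

theorem coeffwise_C (D : Derivation R A A) (a : A) :
    D.coeffwise (Polynomial.C a) = Polynomial.C (D a) :=
  coeffwise_monomial D 0 a

/-- The polynomials `Pₙ(t) = (D + t b)ⁿ 1`. -/
def twistedPoly (D : Derivation R A A) (b : A) : ℕ → Polynomial A
  | 0 => 1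
  | n + 1 => D.coeffwise (twistedPoly D b n) + Polynomial.X * Polynomial.C b * twistedPoly D b n

theorem derivative_coeffwise (D : Derivation R A A) (q : Polynomial A) :
    Polynomial.derivative (D.coeffwise q) = D.coeffwise (Polynomial.derivative q) := by
  ext n
  simp [Polynomial.coeff_derivative, coeff_coeffwise, mul_comm]

theorem derivative_twistedPoly (D : Derivation R A A) (b : A) (n : ℕ) :
    Polynomial.derivative (twistedPoly D b n) =
      ∑ ij ∈ Finset.HasAntidiagonal.antidiagonal n, (n.choose ij.1 : Polynomial A) *
        (Polynomial.C (if ij.1 = 0 then 0 else D^[ij.1 - 1] b) * twistedPoly D b ij.2) := by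
  induction n with
  | zero => simp [twistedPoly]
  | succ n ih =>
    rw [Finset.sum_antidiagonal_choose_succ_mul
      (fun i j => Polynomial.C (if i = 0 then 0 else D^[i - 1] b) * twistedPoly D b j) n]
    have hcorr : ∑ ij ∈ Finset.HasAntidiagonal.antidiagonal n, (n.choose ij.1 : Polynomial A) *
        ((if ij.1 = 0 then Polynomial.C b else 0) * twistedPoly D b ij.2) =
        Polynomial.C b * twistedPoly D b n := by
      rw [Finset.sum_eq_single (0, n)]
      · simp
      · rintro ⟨i, j⟩ hij hne
        have : i ≠ 0 := by
          rintro rfl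
          simp_all
        simp [this]
      · simp
    have hstep : Polynomial.derivative (twistedPoly D b (n + 1)) =
        D.coeffwise (Polynomial.derivative (twistedPoly D b n)) +
        Polynomial.X * Polynomial.C b * Polynomial.derivative (twistedPoly D b n) +
        Polynomial.C b * twistedPoly D b n := by
      rw [twistedPoly, Polynomial.derivative_add, derivative_coeffwise]
      simp only [Polynomial.derivative_mul, Polynomial.derivative_X, Polynomial.derivative_C]
      ring
    rw [hstep, ← hcorr, ih, map_sum, Finset.mul_sum, ← Finset.sum_add_distrib,
      ← Finset.sum_add_distrib, ← Finset.sum_add_distrib]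
    refine Finset.sum_congr rfl fun ij hij => ?_
    rw [Nat.choose_symm_of_eq_add (Finset.HasAntidiagonal.mem_antidiagonal.mp hij).symm]
    obtain ⟨i, j⟩ := ij
    rcases i with _ | i
    · simp [twistedPoly]
    · simp only [leibniz, smul_eq_mul, map_natCast, coeffwise_C, twistedPoly, mul_zero, add_zero,
        Nat.add_eq_zero_iff, one_ne_zero, and_false, if_false, Nat.add_sub_cancel,
        Function.iterate_succ_apply']
      ring

theorem coeff_zero_twistedPoly_succ (D : Derivation R A A) (b : A) (n : ℕ) :
    (twistedPoly D b (n + 1)).coeff 0 = 0 := by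
  induction n with
  | zero => simp [twistedPoly]
  | succ n ih =>
    rw [twistedPoly, Polynomial.coeff_add, coeff_coeffwise, ih, mul_assoc]
    simp

theorem natDegree_twistedPoly_le_and_coeff (D : Derivation R A A) (b : A) (n : ℕ) :
    (twistedPoly D b n).natDegree ≤ n ∧ (twistedPoly D b n).coeff n = b ^ n := by
  induction n with
  | zero => simp [twistedPoly]
  | succ n ih =>
    obtain ⟨hdeg, hcoeff⟩ := ih
    refine ⟨?_, ?_⟩
    · rw [Polynomial.natDegree_le_iff_coeff_eq_zero]
      intro m hm
      obtain ⟨m, rfl⟩ := Nat.exists_eq_succ_of_ne_zero (show m ≠ 0 by omega)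
      rw [twistedPoly, Polynomial.coeff_add, coeff_coeffwise, mul_assoc, Polynomial.coeff_X_mul,
        Polynomial.coeff_C_mul, Polynomial.coeff_eq_zero_of_natDegree_lt (n := m) (by omega),
        Polynomial.coeff_eq_zero_of_natDegree_lt (by omega)]
      simp
    · rw [twistedPoly, Polynomial.coeff_add, coeff_coeffwise, mul_assoc, Polynomial.coeff_X_mul,
        Polynomial.coeff_C_mul, hcoeff,
        Polynomial.coeff_eq_zero_of_natDegree_lt (n := n + 1) (by omega)]
      simp [pow_succ']

theorem eval_one_coeffwise (D : Derivation R A A) (q : Polynomial A) :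
    (D.coeffwise q).eval 1 = D (q.eval 1) := by
  induction q using Polynomial.induction_on' with
  | add q r hq hr => simp [hq, hr]
  | monomial n a => simp [coeffwise_monomial]

theorem iterate_eq_mul_eval_twistedPoly (D : Derivation R A A) {b x : A} (h : D x = x * b)
    (n : ℕ) : D^[n] x = x * (twistedPoly D b n).eval 1 := by
  induction n with
  | zero => simp [twistedPoly]
  | succ n ih =>
    rw [Function.iterate_succ_apply', ih, twistedPoly]
    simp [h, eval_one_coeffwise]
    ring

end CommRing

section Field

variable {k K : Type*} [Field k] [Field K] [Algebra k K] (p : ℕ) [Fact p.Prime] [CharP K p]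

/-- Jacobson's formula: `(D + b)ᵖ 1 = bᵖ + Dᵖ⁻¹ b` in characteristic `p`. -/
theorem eval_one_twistedPoly_char (D : Derivation k K K) (b : K) :
    (twistedPoly D b p).eval 1 = b ^ p + D^[p - 1] b := by
  have hp : p.Prime := Fact.out
  have hder : Polynomial.derivative (twistedPoly D b p) = Polynomial.C (D^[p - 1] b) := by
    rw [derivative_twistedPoly, Finset.sum_eq_single (p, 0)]
    · simp [hp.ne_zero, twistedPoly]
    · rintro ⟨i, j⟩ hij hne
      rw [Finset.HasAntidiagonal.mem_antidiagonal] at hij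
      dsimp only at hij ⊢
      by_cases hi : i = 0
      · simp [hi]
      · have : i < p := by
          refine lt_of_le_of_ne (by omega) ?_
          rintro rfl
          exact hne (by simp; omega)
        rw [(CharP.cast_eq_zero_iff (Polynomial K) p _).mpr (hp.dvd_choose_self hi this), zero_mul]
    · simp
  have hcoeff (m : ℕ) : (twistedPoly D b p).coeff (m + 1) * (m + 1) =
      if m = 0 then D^[p - 1] b else 0 := by
    rw [← Polynomial.coeff_derivative, hder, Polynomial.coeff_C]
  obtain ⟨hdeg, htop⟩ := natDegree_twistedPoly_le_and_coeff D b p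
  obtain ⟨q, rfl⟩ := Nat.exists_eq_succ_of_ne_zero hp.ne_zero
  have hq : q ≠ 0 := by
    rintro rfl
    exact Nat.not_prime_one hp
  rw [Polynomial.eval_eq_sum_range' (Nat.lt_succ_of_le hdeg), Finset.sum_range_succ,
    Finset.sum_range_succ', Finset.sum_eq_single 0]
  · have h1 := hcoeff 0
    simp only [Nat.cast_zero, zero_add, mul_one, if_true] at h1
    rw [htop, coeff_zero_twistedPoly_succ]
    simp [h1, add_comm]
  · intro m hm hm0
    have h1 := hcoeff m
    rw [if_neg hm0] at h1
    have hne : (m + 1 : K) ≠ 0 := by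
      intro h0
      have : ((m + 1 : ℕ) : K) = 0 := by exact_mod_cast h0
      rw [CharP.cast_eq_zero_iff K (q + 1)] at this
      have := Nat.le_of_dvd (Nat.succ_pos _) this
      have := Finset.mem_range.mp hm
      omega
    simp [(mul_eq_zero.mp h1).resolve_right hne]
  · intro h
    exact absurd (Finset.mem_range.mpr (Nat.pos_of_ne_zero hq)) h

/-- Katz's formula `Dᵖ⁻¹ (xᵖ⁻¹ D x) = xᵖ⁻¹ Dᵖ x - (D x)ᵖ` in characteristic `p`. -/
theorem iterate_pred_pow_pred_mul_s3 (D : Derivation k K K) {x : K} (hx : x ≠ 0) :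
    D^[p - 1] (x ^ (p - 1) * D x) = x ^ (p - 1) * D^[p] x - (D x) ^ p := by
  have hp : p.Prime := Fact.out
  have hpow : x ^ p = x ^ (p - 1) * x := by
    rw [← pow_succ, Nat.sub_add_cancel hp.one_le]
  have h1 : x ^ (p - 1) * D x = x ^ p * (D x / x) := by
    rw [hpow]
    field_simp
  rw [h1, iterate_const_mul D (show D (x ^ p) = 0 by simp [leibniz_pow]),
    iterate_eq_mul_eval_twistedPoly D (show D x = x * (D x / x) by field_simp) p,
    eval_one_twistedPoly_char, ← mul_assoc, ← hpow, mul_add, div_pow,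
    mul_div_cancel₀ _ (pow_ne_zero p hx)]
  ring

theorem exists_apply_eq_add (D : Derivation k K K) {x : K} (hx : D x = 1) (w : K) :
    ∃ H, D H = w + x ^ (p - 1) * D^[p - 1] w ∧
      ∀ E : Derivation k K K, E x = 0 → (∀ z, E (D z) = D (E z)) → E w = 0 → E H = 0 := by
  have hp : p.Prime := Fact.out
  have key (n : ℕ) (hn : n < p) : ∃ H, D H = w - (-1) ^ n * x ^ n * (n.factorial : K)⁻¹ * D^[n] w ∧
      ∀ E : Derivation k K K, E x = 0 → (∀ z, E (D z) = D (E z)) → E w = 0 → E H = 0 := by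
    induction n with
    | zero => exact ⟨0, by simp, by simp⟩
    | succ n ih =>
      obtain ⟨H, hH, hE⟩ := ih (by omega)
      have hfac (m : ℕ) (E : Derivation k K K) : E (m.factorial : K)⁻¹ = 0 := by
        simp [leibniz_inv]
      refine ⟨H + (-1) ^ n * x ^ (n + 1) * ((n + 1).factorial : K)⁻¹ * D^[n] w, ?_, ?_⟩
      · have hne : ((n + 1 : ℕ) : K) ≠ 0 := by
          rw [Ne, CharP.cast_eq_zero_iff K p]
          exact Nat.not_dvd_of_pos_of_lt n.succ_pos hn
        have hne' : (n.factorial : K) ≠ 0 := by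
          rw [Ne, CharP.cast_eq_zero_iff K p, hp.dvd_factorial]
          omega
        have hsgn : D ((-1 : K) ^ n) = 0 := by simp [leibniz_pow]
        have hfacD := hfac (n + 1) D
        rw [map_add, hH]
        generalize hc : ((n + 1).factorial : K)⁻¹ = c at hfacD ⊢
        simp only [leibniz, hfacD, hsgn, leibniz_pow, hx, smul_eq_mul, Function.iterate_succ_apply',
          nsmul_eq_mul, Nat.add_sub_cancel]
        rw [← hc, Nat.factorial_succ, Nat.cast_mul]
        field_simp
        ring
      · intro E hEx hcomm hEw
        have hsgn : E ((-1 : K) ^ n) = 0 := by simp [leibniz_pow]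
        have hit : E (D^[n] w) = 0 := by
          have (m : ℕ) : E (D^[m] w) = 0 := by
            induction m with
            | zero => exact hEw
            | succ m ihm => rw [Function.iterate_succ_apply', hcomm, ihm, map_zero]
          exact this n
        simp [leibniz, hfac, hsgn, leibniz_pow, hEx, hit, hE E hEx hcomm hEw]
  obtain ⟨H, hH, hE⟩ := key (p - 1) (Nat.sub_lt hp.pos one_pos)
  refine ⟨H, ?_, hE⟩
  have hw : ((p - 1).factorial : K) = -1 := by
    have := congrArg (ZMod.castHom dvd_rfl K) (ZMod.wilsons_lemma p)
    rw [_root_.map_natCast, _root_.map_neg, _root_.map_one] at this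
    exact this
  have hs : (-1 : K) ^ (p - 1) = 1 := by
    have h1 : (-1 : ZMod p) ^ (p - 1) = 1 := ZMod.pow_card_sub_one_eq_one (by simp)
    have := congrArg (ZMod.castHom dvd_rfl K) h1
    simpa using this
  rw [hH, hw, hs, inv_neg, inv_one]
  ring

/-- The Cartier–Katz formula for a closed form `u dx + v dy` annihilating the derivation `D`. -/
theorem apply_iterate_char_of_closed {x y : K} {Dx Dy : Derivation k K K}
    (hxx : Dx x = 1) (hxy : Dx y = 0) (hyx : Dy x = 0) (hyy : Dy y = 1)
    (hbasis : ∀ (E : Derivation k K K) (h : K), E h = E x * Dx h + E y * Dy h)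
    (D : Derivation k K K) {u v : K} (hclosed : Dy u = Dx v) (hker : u * D x + v * D y = 0) :
    u * D^[p] x + v * D^[p] y =
      -((D x) ^ p * Dx^[p - 1] u) - (D y) ^ p * Dy^[p - 1] v := by
  have hp : p.Prime := Fact.out
  have hpred : p - 1 + 1 = p := Nat.sub_add_cancel hp.one_le
  have hcomm (z : K) : Dy (Dx z) = Dx (Dy z) := by
    have := hbasis ⁅Dy, Dx⁆ z
    simpa [commutator_apply, hxx, hxy, hyx, hyy, sub_eq_zero] using this
  have hpow (E : Derivation k K K) (z : K) :
      E^[p] z = E^[p] x * Dx z + E^[p] y * Dy z := by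
    simpa only [iterateChar_apply_s3] using hbasis (iterateChar_s3 p E) z
  have hnil (E : Derivation k K K) (hx : E (E x) = 0) (hy : E (E y) = 0) (z : K) :
      E^[p] z = 0 := by
    obtain ⟨m, rfl⟩ := Nat.exists_eq_add_of_le' hp.two_le
    rw [hpow]
    simp [Function.iterate_add_apply, hx, hy, iterate_map_zero]
  have hxnil := hnil Dx (by simp [hxx]) (by simp [hxy])
  have hynil := hnil Dy (by simp [hyx]) (by simp [hyy])
  have hcommx (n : ℕ) (z : K) : Dy (Dx^[n] z) = Dx^[n] (Dy z) :=
    (Function.Commute.iterate_right (f := Dy) (g := Dx) hcomm n) z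
  have hcommy (n : ℕ) (z : K) : Dx (Dy^[n] z) = Dy^[n] (Dx z) :=
    (Function.Commute.iterate_right (f := Dx) (g := Dy) (fun z => (hcomm z).symm) n) z
  have hx0 : x ≠ 0 := by
    rintro rfl
    simp at hxx
  have hy0 : y ≠ 0 := by
    rintro rfl
    simp at hyy
  set α := Dx^[p - 1] u with hα
  have hαx : Dx α = 0 := by
    rw [hα, ← Function.iterate_succ_apply' (f := Dx), Nat.succ_eq_add_one, hpred, hxnil]
  have hαy : Dy α = 0 := by
    rw [hα, hcommx, hclosed, ← Function.iterate_succ_apply (f := Dx), Nat.succ_eq_add_one, hpred,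
      hxnil]
  obtain ⟨h₁, hh₁, -⟩ := exists_apply_eq_add p Dx hxx u
  obtain ⟨h₂, hh₂, hh₂'⟩ := exists_apply_eq_add p Dy hyy (v - Dy h₁)
  have hv : Dx (v - Dy h₁) = 0 := by
    rw [map_sub, ← hcomm, hh₁, ← hα]
    simp [leibniz, leibniz_pow, hαy, hyx, hclosed]
  have hh₂x : Dx h₂ = 0 := hh₂' Dx hxy (fun z => (hcomm z).symm) hv
  have hβ' : Dy^[p - 1] (v - Dy h₁) = Dy^[p - 1] v := by
    rw [iterate_map_sub, ← Function.iterate_succ_apply (f := Dy), Nat.succ_eq_add_one, hpred,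
      hynil, sub_zero]
  rw [hβ'] at hh₂
  set β := Dy^[p - 1] v with hβ
  have hβx : Dx β = 0 := by
    rw [← hβ', hcommy, hv, iterate_map_zero]
  have hβy : Dy β = 0 := by
    rw [hβ, ← Function.iterate_succ_apply' (f := Dy), Nat.succ_eq_add_one, hpred, hynil]
  have hDα : D α = 0 := by rw [hbasis D, hαx, hαy]; ring
  have hDβ : D β = 0 := by rw [hbasis D, hβx, hβy]; ring
  have hdx : Dx (h₁ + h₂) = u + x ^ (p - 1) * α := by rw [map_add, hh₁, hh₂x, add_zero]
  have hdy : Dy (h₁ + h₂) = v + y ^ (p - 1) * β := by rw [map_add, hh₂]; ring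
  have hD : D (h₁ + h₂) = α * (x ^ (p - 1) * D x) + β * (y ^ (p - 1) * D y) := by
    rw [hbasis D, hdx, hdy]
    linear_combination hker
  have hDp := congrArg D^[p - 1] hD
  rw [iterate_map_add D (p - 1) (α * _), ← Function.iterate_succ_apply (f := D), Nat.succ_eq_add_one, hpred,
    iterate_const_mul D hDα, iterate_const_mul D hDβ, iterate_pred_pow_pred_mul_s3 p D hx0,
    iterate_pred_pow_pred_mul_s3 p D hy0, hpow, hdx, hdy] at hDp
  linear_combination hDp

end Field

end Derivation

theorem RatFld2.derivation_apply {k : Type} [Field k]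
    {Dx Dy : Derivation k (RatFld2 k) (RatFld2 k)}
    (hDxx : Dx (xK k) = 1) (hDxy : Dx (yK k) = 0)
    (hDyx : Dy (xK k) = 0) (hDyy : Dy (yK k) = 1)
    (E : Derivation k (RatFld2 k) (RatFld2 k)) (h : RatFld2 k) :
    E h = E (xK k) * Dx h + E (yK k) * Dy h := by
  set F := E (xK k) • Dx + E (yK k) • Dy with hF
  have hpoly : E.compAlgebraMap (MvPolynomial (Fin 2) k) =
      F.compAlgebraMap (MvPolynomial (Fin 2) k) := by
    refine MvPolynomial.derivation_ext fun i => ?_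
    change E (algebraMap (MvPolynomial (Fin 2) k) _ (X i)) =
      F (algebraMap (MvPolynomial (Fin 2) k) _ (X i))
    fin_cases i
    · change E (xK k) = E (xK k) * Dx (xK k) + E (yK k) * Dy (xK k)
      rw [hDxx, hDyx]
      ring
    · change E (yK k) = E (xK k) * Dx (yK k) + E (yK k) * Dy (yK k)
      rw [hDxy, hDyy]
      ring
  have hpoly' (q : MvPolynomial (Fin 2) k) :
      E (algebraMap _ (RatFld2 k) q) = F (algebraMap _ (RatFld2 k) q) :=
    DFunLike.congr_fun hpoly q
  change E h = F h
  obtain ⟨r, s, -, rfl⟩ := IsFractionRing.div_surjective (A := MvPolynomial (Fin 2) k) h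
  rw [Derivation.leibniz_div, Derivation.leibniz_div, hpoly', hpoly']

/-- Theorem 2 of the paper: let `K = k(x,y)` with `char k = p > 0`, let `∂_x, ∂_y` be the
partial-derivative `k`-derivations of `K`, let `f, g ∈ K`, and let `a ∈ K` be nonzero with
`∂_x(a·f) + ∂_y(a·g) = 0`. Then for `∂ = f·∂_x + g·∂_y` one has
`a·(∂(x)·∂^p(y) − ∂(y)·∂^p(x)) = f^p·∂_x^{p−1}(a·g) − g^p·∂_y^{p−1}(a·f)`. -/
theorem key_identity_function_field
    (p : ℕ) (hp : p.Prime) (k : Type) [Field k] [CharP k p]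
    (Dx Dy : Derivation k (RatFld2 k) (RatFld2 k))
    (hDxx : Dx (xK k) = 1) (hDxy : Dx (yK k) = 0)
    (hDyx : Dy (xK k) = 0) (hDyy : Dy (yK k) = 1)
    (f g a : RatFld2 k) (ha : a ≠ 0)
    (hdiv : Dx (a * f) + Dy (a * g) = 0) :
    a * ((f • Dx + g • Dy) (xK k) * (⇑(f • Dx + g • Dy))^[p] (yK k)
          - (f • Dx + g • Dy) (yK k) * (⇑(f • Dx + g • Dy))^[p] (xK k))
      = f ^ p * (⇑Dx)^[p - 1] (a * g) - g ^ p * (⇑Dy)^[p - 1] (a * f) := by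
  have : Fact p.Prime := ⟨hp⟩
  have : CharP (RatFld2 k) p := charP_of_injective_algebraMap (algebraMap k (RatFld2 k)).injective p
  have hx : (f • Dx + g • Dy) (xK k) = f := by simp [hDxx, hDyx]
  have hy : (f • Dx + g • Dy) (yK k) = g := by simp [hDxy, hDyy]
  have key := Derivation.apply_iterate_char_of_closed p hDxx hDxy hDyx hDyy
    (RatFld2.derivation_apply hDxx hDxy hDyx hDyy) (f • Dx + g • Dy)
    (u := -(a * g)) (v := a * f)
    (by rw [map_neg]; linear_combination -hdiv) (by rw [hx, hy]; ring)
  rw [hx, hy, iterate_map_neg] at key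
  rw [hx, hy]
  linear_combination key
end
end

section
/- Let k be a field of characteristic p > 0 and K = k(x,y). Let f, g ∈ K, not both zero, and set ∂ = f·∂_x + g·∂_y. Then there exists a ∈ K with ∂^p = a·∂ (i.e., ∂ is p-closed) if and only if ∂(x)·∂^p(y) − ∂(y)·∂^p(x) = 0, i.e., if and only if f·∂^p(y) = g·∂^p(x). -/
open MvPolynomial

noncomputable section

namespace Derivation

/-- The general Leibniz rule for iterates of a derivation. -/
theorem iterate_apply_mul {R A : Type*} [CommRing R] [CommRing A] [Algebra R A]
    (D : Derivation R A A) (n : ℕ) (a b : A) :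
    D^[n] (a * b) =
      ∑ ij ∈ Finset.HasAntidiagonal.antidiagonal n, n.choose ij.1 • (D^[ij.1] a * D^[ij.2] b) := by
  induction n with
  | zero => simp
  | succ n ih =>
    rw [Finset.sum_antidiagonal_choose_succ_nsmul (fun i j => D^[i] a * D^[j] b) n]
    simp only [Function.iterate_succ_apply', ih, map_sum, map_nsmul, leibniz, smul_eq_mul,
      smul_add, Finset.sum_add_distrib]
    congr 1
    refine Finset.sum_congr rfl fun ij hij => ?_
    rw [n.choose_symm_of_eq_add (Finset.HasAntidiagonal.mem_antidiagonal.1 hij).symm, mul_comm]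

/-- In characteristic `p`, the `p`-th iterate of a derivation satisfies the Leibniz rule. -/
theorem iterate_prime_mul {R A : Type*} [CommRing R] [CommRing A] [Algebra R A]
    (p : ℕ) (hp : p.Prime) [CharP A p] (D : Derivation R A A) (a b : A) :
    D^[p] (a * b) = a * D^[p] b + b * D^[p] a := by
  rw [iterate_apply_mul, Finset.sum_eq_add (0, p) (p, 0)]
  · simp [mul_comm]
  · simp [hp.ne_zero.symm]
  · rintro ⟨i, j⟩ hij ⟨h0, h1⟩
    have hsum : i + j = p := Finset.HasAntidiagonal.mem_antidiagonal.1 hij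
    have hi0 : i ≠ 0 := by rintro rfl; exact h0 (by simp_all)
    have hip : i < p := by
      refine lt_of_le_of_ne (by omega) fun h => h1 ?_
      rw [Prod.mk.injEq]
      omega
    have hchoose : (p.choose i : A) = 0 :=
      (CharP.cast_eq_zero_iff A p _).2 (hp.dvd_choose_self hi0 hip)
    rw [nsmul_eq_mul, hchoose, zero_mul]
  · simp
  · simp

/-- In characteristic `p`, the `p`-th iterate of a derivation, as a derivation. -/
def iteratePrime {R A : Type*} [CommRing R] [CommRing A] [Algebra R A]
    (p : ℕ) (hp : p.Prime) [CharP A p] (D : Derivation R A A) : Derivation R A A :=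
  mk' ((D : A →ₗ[R] A) ^ p) fun a b => by
    simpa [Module.End.pow_apply] using iterate_prime_mul p hp D a b

theorem iteratePrime_apply {R A : Type*} [CommRing R] [CommRing A] [Algebra R A]
    (p : ℕ) (hp : p.Prime) [CharP A p] (D : Derivation R A A) (a : A) :
    iteratePrime p hp D a = D^[p] a := by
  simp [iteratePrime, Module.End.pow_apply]

/-- Derivations of a field of fractions that agree on the base domain are equal. -/
theorem ext_of_isFractionRing {R A K : Type*} [CommRing R] [CommRing A] [IsDomain A] [Field K]
    [Algebra R K] [Algebra A K] [IsFractionRing A K] {D₁ D₂ : Derivation R K K}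
    (h : ∀ a : A, D₁ (algebraMap A K a) = D₂ (algebraMap A K a)) : D₁ = D₂ := by
  ext z
  obtain ⟨a, b, -, rfl⟩ := IsFractionRing.div_surjective (A := A) z
  rw [leibniz_div, leibniz_div, h, h]

end Derivation

/-- A `k`-derivation of `k(x,y)` is determined by its values on `x` and `y`. -/
theorem RatFld2.derivation_ext {k : Type} [Field k] {D₁ D₂ : Derivation k (RatFld2 k) (RatFld2 k)}
    (hx : D₁ (xK k) = D₂ (xK k)) (hy : D₁ (yK k) = D₂ (yK k)) : D₁ = D₂ := by
  refine Derivation.ext_of_isFractionRing (A := MvPolynomial (Fin 2) k) fun a => ?_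
  have h : D₁.compAlgebraMap (MvPolynomial (Fin 2) k) =
      D₂.compAlgebraMap (MvPolynomial (Fin 2) k) := by
    refine MvPolynomial.derivation_ext fun i => ?_
    fin_cases i
    · exact hx
    · exact hy
  exact Derivation.congr_fun h a

/-- For `K = k(x,y)` (`char k = p > 0`), `f, g ∈ K` not both zero, and
`∂ = f·∂_x + g·∂_y`, the derivation `∂` is `p`-closed (i.e. `∂^p = a·∂` for some `a ∈ K`)
if and only if `∂(x)·∂^p(y) − ∂(y)·∂^p(x) = 0`, i.e. iff `f·∂^p(y) = g·∂^p(x)`. -/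
theorem p_closed_iff_wronskian_vanishes
    (p : ℕ) (hp : p.Prime) (k : Type) [Field k] [CharP k p]
    (Dx Dy : Derivation k (RatFld2 k) (RatFld2 k))
    (hDxx : Dx (xK k) = 1) (hDxy : Dx (yK k) = 0)
    (hDyx : Dy (xK k) = 0) (hDyy : Dy (yK k) = 1)
    (f g : RatFld2 k) (hfg : ¬(f = 0 ∧ g = 0)) :
    (∃ a : RatFld2 k, ∀ z, (⇑(f • Dx + g • Dy))^[p] z = a * (f • Dx + g • Dy) z)
      ↔ f * (⇑(f • Dx + g • Dy))^[p] (yK k) = g * (⇑(f • Dx + g • Dy))^[p] (xK k) := by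
  have : CharP (RatFld2 k) p :=
    charP_of_injective_algebraMap (algebraMap k (RatFld2 k)).injective p
  set D := f • Dx + g • Dy with hD
  have hDx : D (xK k) = f := by simp [hD, hDxx, hDyx]
  have hDy : D (yK k) = g := by simp [hD, hDxy, hDyy]
  constructor
  · rintro ⟨a, ha⟩
    rw [ha, ha, hDx, hDy]
    ring
  · intro h
    obtain ⟨a, hax, hay⟩ : ∃ a, D^[p] (xK k) = a * f ∧ D^[p] (yK k) = a * g := by
      by_cases hf : f = 0
      · have hg : g ≠ 0 := fun hg => hfg ⟨hf, hg⟩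
        refine ⟨D^[p] (yK k) / g, ?_, by field_simp⟩
        rw [hf, zero_mul, eq_comm, mul_eq_zero] at h
        rw [hf, mul_zero]
        exact h.resolve_left hg
      · refine ⟨D^[p] (xK k) / f, by field_simp, ?_⟩
        field_simp
        linear_combination h
    have key : D.iteratePrime p hp = a • D :=
      RatFld2.derivation_ext (by simp [Derivation.iteratePrime_apply, hax, hDx])
        (by simp [Derivation.iteratePrime_apply, hay, hDy])
    refine ⟨a, fun z => ?_⟩
    rw [← Derivation.iteratePrime_apply p hp, key, Derivation.smul_apply, smul_eq_mul]
end
end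

section
/- Let k be a field of characteristic p > 0 and K = k(x,y). Let f, g ∈ K, not both zero, with ∂_x(f) + ∂_y(g) = 0, and set c_f = −∂_y^{p−1}(f) and c_g = −∂_x^{p−1}(g). Then f^p·c_g = g^p·c_f if and only if there exists c ∈ k(x^p, y^p) such that c_f = c·f^p and c_g = c·g^p. -/
open MvPolynomial

noncomputable section

section

variable {k : Type} [Field k] {p : ℕ}

lemma derivation_algebraMap_eq (D : Derivation k (RatFld2 k) (RatFld2 k))
    (P : MvPolynomial (Fin 2) k) :
    D (algebraMap _ (RatFld2 k) P) =
      algebraMap _ (RatFld2 k) (pderiv 0 P) * D (xK k) +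
        algebraMap _ (RatFld2 k) (pderiv 1 P) * D (yK k) := by
  induction P using MvPolynomial.induction_on with
  | C a =>
    have h : algebraMap (MvPolynomial (Fin 2) k) (RatFld2 k) (C a) =
        algebraMap k (RatFld2 k) a := by
      rw [IsScalarTower.algebraMap_apply k (MvPolynomial (Fin 2) k) (RatFld2 k)]; rfl
    rw [h]; simp
  | add P Q hP hQ => simp only [map_add, hP, hQ]; ring
  | mul_X P i hP =>
    rw [map_mul, Derivation.leibniz, hP]
    fin_cases i <;> simp [Derivation.leibniz, pderiv_X] <;> ring

lemma exists_algebraMap_eq_pow_mul (hp : p ≠ 0) (q : RatFld2 k) :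
    ∃ P b : MvPolynomial (Fin 2) k, algebraMap _ (RatFld2 k) b ≠ 0 ∧
      algebraMap _ (RatFld2 k) P = algebraMap _ (RatFld2 k) b ^ p * q := by
  obtain ⟨a, b, hb, rfl⟩ := IsFractionRing.div_surjective (A := MvPolynomial (Fin 2) k) q
  have hb0 : algebraMap _ (RatFld2 k) b ≠ 0 := by
    simpa using nonZeroDivisors.ne_zero hb
  refine ⟨a * b ^ (p - 1), b, hb0, ?_⟩
  obtain ⟨n, rfl⟩ := Nat.exists_eq_succ_of_ne_zero hp
  simp only [map_mul, map_pow, Nat.succ_eq_add_one, Nat.add_sub_cancel]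
  field_simp
  ring

lemma derivation_pow_char_mul [CharP k p] (D : Derivation k (RatFld2 k) (RatFld2 k))
    (b q : RatFld2 k) : D (b ^ p * q) = b ^ p * D q := by
  have : CharP (RatFld2 k) p := charP_of_injective_algebraMap (algebraMap k _).injective p
  simp [Derivation.leibniz, Derivation.leibniz_pow]

lemma iterate_derivation_pow_char_mul [CharP k p] (D : Derivation k (RatFld2 k) (RatFld2 k))
    (b q : RatFld2 k) (n : ℕ) : (⇑D)^[n] (b ^ p * q) = b ^ p * (⇑D)^[n] q := by
  induction n with
  | zero => rfl
  | succ n ih => rw [Function.iterate_succ_apply', ih, derivation_pow_char_mul,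
      Function.iterate_succ_apply']

lemma derivation_eq_zero_of_apply_X [CharP k p] (hp : p ≠ 0)
    (D : Derivation k (RatFld2 k) (RatFld2 k)) (hx : D (xK k) = 0) (hy : D (yK k) = 0)
    (q : RatFld2 k) : D q = 0 := by
  obtain ⟨P, b, hb, h⟩ := exists_algebraMap_eq_pow_mul hp q
  have := derivation_pow_char_mul (p := p) D (algebraMap _ _ b) q
  rw [← h, derivation_algebraMap_eq, hx, hy, mul_zero, mul_zero, add_zero] at this
  exact (mul_eq_zero.1 this.symm).resolve_left (pow_ne_zero p hb)

lemma iterate_pderiv_monomial {σ R : Type*} [CommSemiring R] (i : σ) (s : σ →₀ ℕ) (a : R)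
    (n : ℕ) : (⇑(pderiv i))^[n] (monomial s a) =
      monomial (s - Finsupp.single i n) (a * ((s i).descFactorial n : R)) := by
  induction n with
  | zero => simp
  | succ n ih =>
    rw [Function.iterate_succ_apply', ih, pderiv_monomial, tsub_tsub, ← Finsupp.single_add]
    congr 1
    simp [Nat.descFactorial_succ]
    ring

lemma iterate_pderiv_eq_zero_of_charP {σ R : Type*} [CommSemiring R] [CharP R p] (hp : p ≠ 0)
    (i : σ) (P : MvPolynomial σ R) : (⇑(pderiv i))^[p] P = 0 := by
  induction P using MvPolynomial.induction_on' with
  | monomial s a =>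
    have h : (((s i).descFactorial p : ℕ) : R) = 0 :=
      (CharP.cast_eq_zero_iff R p _).2
        ((Nat.dvd_factorial (Nat.pos_of_ne_zero hp) le_rfl).trans
          (Nat.factorial_dvd_descFactorial _ _))
    rw [iterate_pderiv_monomial, h]
    simp
  | add P Q hP hQ => rw [iterate_map_add, hP, hQ, add_zero]

lemma iterate_derivation_eq_zero [CharP k p] (hp : p ≠ 0)
    (D : Derivation k (RatFld2 k) (RatFld2 k)) (i : Fin 2)
    (hD : ∀ P : MvPolynomial (Fin 2) k,
      D (algebraMap _ (RatFld2 k) P) = algebraMap _ (RatFld2 k) (pderiv i P))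
    (q : RatFld2 k) : (⇑D)^[p] q = 0 := by
  obtain ⟨P, b, hb, h⟩ := exists_algebraMap_eq_pow_mul hp q
  have := iterate_derivation_pow_char_mul (p := p) D (algebraMap _ _ b) q p
  have hc : Function.Semiconj (algebraMap (MvPolynomial (Fin 2) k) (RatFld2 k))
      (pderiv i) D := fun P => (hD P).symm
  rw [← h, ← (hc.iterate_right p) P, iterate_pderiv_eq_zero_of_charP hp, map_zero] at this
  exact (mul_eq_zero.1 this.symm).resolve_left (pow_ne_zero p hb)

lemma dvd_of_pderiv_eq_zero [CharP k p] {σ : Type*} {i : σ} {P : MvPolynomial σ k}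
    (h : pderiv i P = 0) {s : σ →₀ ℕ} (hs : s ∈ P.support) : p ∣ s i := by
  rcases Nat.eq_zero_or_pos (s i) with h0 | hpos
  · simp [h0]
  have hle : Finsupp.single i 1 ≤ s := by simpa [Nat.one_le_iff_ne_zero] using hpos.ne'
  have hc := congrArg (coeff (s - Finsupp.single i 1)) h
  rw [coeff_pderiv, tsub_add_cancel_of_le hle, coeff_zero] at hc
  rw [mem_support_iff] at hs
  rw [← CharP.cast_eq_zero_iff k p, ← (mul_eq_zero.1 hc).resolve_left hs]
  simp only [Finsupp.coe_tsub, Pi.sub_apply, Finsupp.single_eq_same]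
  rw [← Nat.cast_succ, Nat.succ_eq_add_one, Nat.sub_add_cancel hpos]

lemma pow_char_algebraMap_mem_adjoin [CharP k p] (hp : p.Prime) (P : MvPolynomial (Fin 2) k) :
    algebraMap _ (RatFld2 k) P ^ p ∈ IntermediateField.adjoin k {xK k ^ p, yK k ^ p} := by
  have : Fact p.Prime := ⟨hp⟩
  have : CharP (RatFld2 k) p := charP_of_injective_algebraMap (algebraMap k _).injective p
  induction P using MvPolynomial.induction_on with
  | C a =>
    have h : algebraMap (MvPolynomial (Fin 2) k) (RatFld2 k) (C a) =
        algebraMap k (RatFld2 k) a := by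
      rw [IsScalarTower.algebraMap_apply k (MvPolynomial (Fin 2) k) (RatFld2 k)]; rfl
    rw [h]
    exact pow_mem (IntermediateField.algebraMap_mem _ a) p
  | add P Q hP hQ => rw [map_add, add_pow_char]; exact add_mem hP hQ
  | mul_X P i hP =>
    rw [map_mul, mul_pow]
    refine mul_mem hP (IntermediateField.subset_adjoin _ _ ?_)
    fin_cases i <;> simp

lemma pow_char_mem_adjoin [CharP k p] (hp : p.Prime) (q : RatFld2 k) :
    q ^ p ∈ IntermediateField.adjoin k {xK k ^ p, yK k ^ p} := by
  obtain ⟨a, b, -, rfl⟩ := IsFractionRing.div_surjective (A := MvPolynomial (Fin 2) k) q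
  rw [div_pow]
  exact div_mem (pow_char_algebraMap_mem_adjoin hp a) (pow_char_algebraMap_mem_adjoin hp b)

lemma mem_adjoin_of_derivation_eq_zero [CharP k p] (hp : p.Prime)
    (Dx Dy : Derivation k (RatFld2 k) (RatFld2 k))
    (hDx : ∀ P : MvPolynomial (Fin 2) k,
      Dx (algebraMap _ (RatFld2 k) P) = algebraMap _ (RatFld2 k) (pderiv 0 P))
    (hDy : ∀ P : MvPolynomial (Fin 2) k,
      Dy (algebraMap _ (RatFld2 k) P) = algebraMap _ (RatFld2 k) (pderiv 1 P))
    {q : RatFld2 k} (hx : Dx q = 0) (hy : Dy q = 0) :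
    q ∈ IntermediateField.adjoin k {xK k ^ p, yK k ^ p} := by
  obtain ⟨P, b, hb, h⟩ := exists_algebraMap_eq_pow_mul hp.ne_zero q
  have hPx : pderiv 0 P = 0 := by
    apply IsFractionRing.injective (MvPolynomial (Fin 2) k) (RatFld2 k)
    rw [← hDx, h, derivation_pow_char_mul, hx, mul_zero, map_zero]
  have hPy : pderiv 1 P = 0 := by
    apply IsFractionRing.injective (MvPolynomial (Fin 2) k) (RatFld2 k)
    rw [← hDy, h, derivation_pow_char_mul, hy, mul_zero, map_zero]
  have hP : algebraMap _ (RatFld2 k) P ∈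
      IntermediateField.adjoin k {xK k ^ p, yK k ^ p} := by
    rw [P.as_sum, map_sum]
    refine sum_mem fun s hs => ?_
    obtain ⟨m, hm⟩ := dvd_of_pderiv_eq_zero hPx hs
    obtain ⟨n, hn⟩ := dvd_of_pderiv_eq_zero hPy hs
    have hmon : monomial s (P.coeff s) =
        P.coeff s • (X 0 ^ m * X 1 ^ n : MvPolynomial (Fin 2) k) ^ p := by
      rw [monomial_eq, Finsupp.prod_fintype _ _ (by simp), Fin.prod_univ_two, hm, hn,
        smul_eq_C_mul, mul_comm p m, mul_comm p n, pow_mul, pow_mul, mul_pow]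
    rw [hmon, Algebra.smul_def, map_mul, ← IsScalarTower.algebraMap_apply, map_pow]
    exact mul_mem (IntermediateField.algebraMap_mem _ _) (pow_char_mem_adjoin hp _)
  rw [eq_div_of_mul_eq (pow_ne_zero p hb) ((mul_comm _ _).trans h.symm)]
  exact div_mem hP (pow_char_mem_adjoin hp _)

end

/-- For `K = k(x,y)` (`char k = p > 0`), `f, g ∈ K` not both zero with
`∂_x(f) + ∂_y(g) = 0`, set `c_f = −∂_y^{p−1}(f)` and `c_g = −∂_x^{p−1}(g)`.
Then `f^p·c_g = g^p·c_f` iff there is `c` in the subfield `k(x^p, y^p)` with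
`c_f = c·f^p` and `c_g = c·g^p`. -/
theorem cf_cg_identity_iff_common_multiplier
    (p : ℕ) (hp : p.Prime) (k : Type) [Field k] [CharP k p]
    (Dx Dy : Derivation k (RatFld2 k) (RatFld2 k))
    (hDxx : Dx (xK k) = 1) (hDxy : Dx (yK k) = 0)
    (hDyx : Dy (xK k) = 0) (hDyy : Dy (yK k) = 1)
    (f g : RatFld2 k) (hfg : ¬(f = 0 ∧ g = 0))
    (hdiv : Dx f + Dy g = 0)
    (cf cg : RatFld2 k)
    (hcf : cf = -(⇑Dy)^[p - 1] f) (hcg : cg = -(⇑Dx)^[p - 1] g)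
    (L : IntermediateField k (RatFld2 k))
    (hL : L = IntermediateField.adjoin k {xK k ^ p, yK k ^ p}) :
    f ^ p * cg = g ^ p * cf
      ↔ ∃ c : RatFld2 k, c ∈ L ∧ cf = c * f ^ p ∧ cg = c * g ^ p := by
  subst hcf hcg hL
  have hDx : ∀ P : MvPolynomial (Fin 2) k,
      Dx (algebraMap _ (RatFld2 k) P) = algebraMap _ (RatFld2 k) (pderiv 0 P) := by
    intro P; rw [derivation_algebraMap_eq, hDxx, hDxy]; ring
  have hDy : ∀ P : MvPolynomial (Fin 2) k,
      Dy (algebraMap _ (RatFld2 k) P) = algebraMap _ (RatFld2 k) (pderiv 1 P) := by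
    intro P; rw [derivation_algebraMap_eq, hDyx, hDyy]; ring
  have hcomm : Function.Commute Dx Dy := fun q => by
    have := derivation_eq_zero_of_apply_X hp.ne_zero ⁅Dx, Dy⁆
      (by simp [Derivation.commutator_apply, hDxx, hDyx])
      (by simp [Derivation.commutator_apply, hDxy, hDyy]) q
    rwa [Derivation.commutator_apply, sub_eq_zero] at this
  have hpx := iterate_derivation_eq_zero hp.ne_zero Dx 0 hDx
  have hpy := iterate_derivation_eq_zero hp.ne_zero Dy 1 hDy
  have hsucc : p - 1 + 1 = p := Nat.sub_add_cancel hp.one_le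
  have hf : (⇑Dy)^[p - 1] f ∈ IntermediateField.adjoin k {xK k ^ p, yK k ^ p} := by
    refine mem_adjoin_of_derivation_eq_zero hp Dx Dy hDx hDy ?_ ?_
    · rw [(hcomm.iterate_right (p - 1)) f, eq_neg_of_add_eq_zero_left hdiv, iterate_map_neg,
        ← Function.iterate_succ_apply, Nat.succ_eq_add_one, hsucc, hpy, neg_zero]
    · rw [← Function.iterate_succ_apply' Dy, Nat.succ_eq_add_one, hsucc, hpy]
  have hg : (⇑Dx)^[p - 1] g ∈ IntermediateField.adjoin k {xK k ^ p, yK k ^ p} := by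
    refine mem_adjoin_of_derivation_eq_zero hp Dx Dy hDx hDy ?_ ?_
    · rw [← Function.iterate_succ_apply' Dx, Nat.succ_eq_add_one, hsucc, hpx]
    · rw [(hcomm.symm.iterate_right (p - 1)) g, eq_neg_of_add_eq_zero_right hdiv, iterate_map_neg,
        ← Function.iterate_succ_apply, Nat.succ_eq_add_one, hsucc, hpx, neg_zero]
  constructor
  · intro h
    by_cases hf0 : f = 0
    · have hg0 : g ≠ 0 := fun hg0 => hfg ⟨hf0, hg0⟩
      refine ⟨-(⇑Dx)^[p - 1] g / g ^ p, div_mem (neg_mem hg) (pow_char_mem_adjoin hp g), ?_, ?_⟩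
      · rw [hf0, iterate_map_zero, zero_pow hp.ne_zero, neg_zero, mul_zero]
      · rw [div_mul_cancel₀ _ (pow_ne_zero p hg0)]
    · refine ⟨-(⇑Dy)^[p - 1] f / f ^ p, div_mem (neg_mem hf) (pow_char_mem_adjoin hp f), ?_, ?_⟩
      · rw [div_mul_cancel₀ _ (pow_ne_zero p hf0)]
      · rw [div_mul_eq_mul_div, eq_div_iff (pow_ne_zero p hf0), mul_comm, h, mul_comm]
  · rintro ⟨c, -, h1, h2⟩
    rw [h1, h2]; ring
end
end

section
/- Let k be a field of characteristic p > 0 and R = k[x,y]. Suppose f, g ∈ R satisfy ∂_x(f) + ∂_y(g) = 0, and set c_f = −∂_y^{p−1}(f) and c_g = −∂_x^{p−1}(g). Then there exists h ∈ R such that f = ∂_y(h) + c_f·y^{p−1} and g = −∂_x(h) + c_g·x^{p−1}. -/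
open MvPolynomial

noncomputable section

namespace MvPolynomial

variable {σ k : Type*} [Field k]

/-- Termwise integration in the variable `i`, sending to zero the monomials that have no
primitive. -/
def termwiseIntegral (i : σ) : MvPolynomial σ k →ₗ[k] MvPolynomial σ k :=
  (basisMonomials σ k).constr k fun m ↦
    monomial (m + Finsupp.single i 1) ((m i + 1 : k)⁻¹)

theorem termwiseIntegral_monomial (i : σ) (m : σ →₀ ℕ) (c : k) :
    termwiseIntegral i (monomial m c) =
      monomial (m + Finsupp.single i 1) (c * (m i + 1 : k)⁻¹) := by
  have h : monomial m c = c • basisMonomials σ k m := by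
    simp [smul_monomial]
  rw [h, map_smul, termwiseIntegral, Module.Basis.constr_basis, smul_monomial, smul_eq_mul]

theorem termwiseIntegral_pderiv_comm {i j : σ} (hij : i ≠ j) (u : MvPolynomial σ k) :
    pderiv j (termwiseIntegral i u) = termwiseIntegral i (pderiv j u) := by
  induction u using MvPolynomial.induction_on' with
  | add a b ha hb => simp only [map_add, ha, hb]
  | monomial m c =>
    rw [termwiseIntegral_monomial, pderiv_monomial, pderiv_monomial, termwiseIntegral_monomial]
    have hexp : m + Finsupp.single i 1 - Finsupp.single j 1 =
        m - Finsupp.single j 1 + Finsupp.single i 1 := by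
      classical
      ext l
      simp only [Finsupp.tsub_apply, Finsupp.add_apply, Finsupp.single_apply]
      grind
    have hi : (m - Finsupp.single j 1 : σ →₀ ℕ) i = m i := by
      simp [Finsupp.single_eq_of_ne hij]
    have hj : (m + Finsupp.single i 1 : σ →₀ ℕ) j = m j := by
      simp [Finsupp.single_eq_of_ne hij.symm]
    rw [hexp, hi, hj]
    congr 1
    ring

theorem iterate_pderiv_monomial (i : σ) (n : ℕ) (m : σ →₀ ℕ) (c : k) :
    (⇑(pderiv i))^[n] (monomial m c) =
      monomial (m - Finsupp.single i n) (c * ((m i).descFactorial n : k)) := by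
  induction n with
  | zero => simp
  | succ n ih =>
    rw [Function.iterate_succ_apply', ih, pderiv_monomial, tsub_tsub, ← Finsupp.single_add,
      Nat.descFactorial_succ]
    congr 1
    simp only [Finsupp.tsub_apply, Finsupp.single_eq_same]
    push_cast
    ring

theorem iterate_pderiv_add (i : σ) (n : ℕ) (u v : MvPolynomial σ k) :
    (⇑(pderiv i))^[n] (u + v) = (⇑(pderiv i))^[n] u + (⇑(pderiv i))^[n] v :=
  iterate_map_add (pderiv i) n u v

theorem iterate_pderiv_char (p : ℕ) (hp : p.Prime) [CharP k p] (i : σ)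
    (u : MvPolynomial σ k) : (⇑(pderiv i))^[p] u = 0 := by
  induction u using MvPolynomial.induction_on' with
  | add a b ha hb => rw [iterate_pderiv_add, ha, hb, add_zero]
  | monomial m c =>
    have h : (((m i).descFactorial p : ℕ) : k) = 0 :=
      (CharP.cast_eq_zero_iff k p _).2
        ((Nat.dvd_factorial hp.pos le_rfl).trans (Nat.factorial_dvd_descFactorial _ _))
    rw [iterate_pderiv_monomial, h, mul_zero, monomial_zero]

theorem iterate_pderiv_pred_pderiv (p : ℕ) (hp : p.Prime) [CharP k p] (i : σ)
    (u : MvPolynomial σ k) : (⇑(pderiv i))^[p - 1] (pderiv i u) = 0 := by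
  rw [← Function.iterate_succ_apply, Nat.succ_eq_add_one, Nat.sub_add_cancel hp.one_le,
    iterate_pderiv_char p hp]

theorem iterate_pderiv_comm (i j : σ) (n : ℕ) (u : MvPolynomial σ k) :
    pderiv j ((⇑(pderiv i))^[n] u) = (⇑(pderiv i))^[n] (pderiv j u) := by
  refine Function.Commute.iterate_right (f := ⇑(pderiv (R := k) j)) (fun v ↦ ?_) n u
  have h : ⁅pderiv (R := k) j, pderiv (R := k) i⁆ = 0 := by
    classical
    ext l
    simp [Derivation.commutator_apply, pderiv_X, Pi.single_apply, apply_ite]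
  have := DFunLike.congr_fun h v
  rwa [Derivation.commutator_apply, Derivation.zero_apply, sub_eq_zero] at this

theorem cast_descFactorial_pred_of_ne (p : ℕ) (hp : p.Prime) [CharP k p] {a : ℕ}
    (ha : (a + 1 : k) ≠ 0) : (a.descFactorial (p - 1) : k) = 0 := by
  have h : (((a + 1).descFactorial (p - 1 + 1) : ℕ) : k) = 0 := by
    rw [Nat.sub_add_cancel hp.one_le]
    exact (CharP.cast_eq_zero_iff k p _).2
      ((Nat.dvd_factorial hp.pos le_rfl).trans (Nat.factorial_dvd_descFactorial _ _))
  rw [Nat.succ_descFactorial_succ] at h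
  push_cast at h
  exact (mul_eq_zero.1 h).resolve_left ha

theorem cast_descFactorial_pred_of_eq (p : ℕ) (hp : p.Prime) [CharP k p] {a : ℕ}
    (ha : (a + 1 : k) = 0) : (a.descFactorial (p - 1) : k) = -1 := by
  have hpa : ((p - 1 : ℕ) : k) = a := by
    rw [Nat.cast_sub hp.one_le, CharP.cast_eq_zero, eq_neg_of_add_eq_zero_left ha]
    simp
  rw [← descPochhammer_eval_eq_descFactorial, ← hpa, descPochhammer_eval_eq_descFactorial,
    Nat.descFactorial_self]
  have : Fact p.Prime := ⟨hp⟩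
  have h := congrArg (ZMod.castHom (dvd_refl p) k) (ZMod.wilsons_lemma p)
  rwa [map_natCast, map_neg, map_one] at h

theorem eq_pderiv_termwiseIntegral_add (p : ℕ) (hp : p.Prime) [CharP k p] (i : σ)
    (u : MvPolynomial σ k) :
    u = pderiv i (termwiseIntegral i u) + -(⇑(pderiv i))^[p - 1] u * X i ^ (p - 1) := by
  induction u using MvPolynomial.induction_on' with
  | add a b ha hb =>
    rw [iterate_pderiv_add, map_add, map_add]
    linear_combination ha + hb
  | monomial m c =>
    rw [termwiseIntegral_monomial, pderiv_monomial, iterate_pderiv_monomial,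
      add_tsub_cancel_right, Finsupp.add_apply, Finsupp.single_eq_same]
    push_cast
    by_cases h : (m i + 1 : k) = 0
    · have hle : p - 1 ≤ m i := by
        have : p ∣ m i + 1 := (CharP.cast_eq_zero_iff k p _).1 (by exact_mod_cast h)
        have := Nat.le_of_dvd (Nat.succ_pos _) this
        lia
      rw [cast_descFactorial_pred_of_eq p hp h, h, X_pow_eq_monomial, ← map_neg, monomial_mul,
        tsub_add_cancel_of_le (Finsupp.single_le_iff.2 hle)]
      simp
    · rw [cast_descFactorial_pred_of_ne p hp h, mul_assoc, inv_mul_cancel₀ h]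
      simp

end MvPolynomial

/-- If `f, g ∈ k[x,y]` (`char k = p > 0`) satisfy `∂_x(f) + ∂_y(g) = 0`, and
`c_f = −∂_y^{p−1}(f)`, `c_g = −∂_x^{p−1}(g)`, then there exists `h ∈ k[x,y]` with
`f = ∂_y(h) + c_f·y^{p−1}` and `g = −∂_x(h) + c_g·x^{p−1}`. -/
theorem exists_hamiltonian_potential
    (p : ℕ) (hp : p.Prime) (k : Type) [Field k] [CharP k p]
    (f g : MvPolynomial (Fin 2) k)
    (hdiv : Px k f + Py k g = 0)
    (cf cg : MvPolynomial (Fin 2) k)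
    (hcf : cf = -(⇑(Py k))^[p - 1] f) (hcg : cg = -(⇑(Px k))^[p - 1] g) :
    ∃ h : MvPolynomial (Fin 2) k,
      f = Py k h + cf * X 1 ^ (p - 1) ∧ g = -Px k h + cg * X 0 ^ (p - 1) := by
  have hF := eq_pderiv_termwiseIntegral_add p hp 1 f
  have hG := eq_pderiv_termwiseIntegral_add p hp 0 g
  rw [← hcf] at hF
  rw [← hcg] at hG
  have hcomm (u : MvPolynomial (Fin 2) k) : pderiv 0 (pderiv 1 u) = pderiv 1 (pderiv 0 u) :=
    iterate_pderiv_comm 1 0 1 u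
  have hcf0 : pderiv 0 cf = 0 := by
    rw [hcf, map_neg, iterate_pderiv_comm, eq_neg_of_add_eq_zero_left hdiv, ← map_neg,
      iterate_pderiv_pred_pderiv p hp, neg_zero]
  have hcg0 : pderiv 1 cg = 0 := by
    rw [hcg, map_neg, iterate_pderiv_comm, eq_neg_of_add_eq_zero_right hdiv, ← map_neg,
      iterate_pderiv_pred_pderiv p hp, neg_zero]
  set a := termwiseIntegral 1 f
  set b := termwiseIntegral 0 g
  have hdivF := congrArg (pderiv 0) hF
  have hdivG := congrArg (pderiv 1) hG
  simp only [map_add, pderiv_mul, pderiv_pow, hcf0, hcg0,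
    pderiv_X_of_ne (R := k) (show (1 : Fin 2) ≠ 0 by decide),
    pderiv_X_of_ne (R := k) (show (0 : Fin 2) ≠ 1 by decide),
    zero_mul, mul_zero, add_zero] at hdivF hdivG
  have hR := eq_pderiv_termwiseIntegral_add p hp 0 (pderiv 0 (a + b))
  rw [iterate_pderiv_pred_pderiv p hp, neg_zero, zero_mul, add_zero] at hR
  have hR1 : pderiv 1 (termwiseIntegral 0 (pderiv 0 (a + b))) = 0 := by
    rw [termwiseIntegral_pderiv_comm (by decide), map_add, map_add, ← hcomm a, ← hdivF,
      ← hdivG, hdiv, map_zero]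
  refine ⟨a - termwiseIntegral 0 (pderiv 0 (a + b)), ?_, ?_⟩
  · rw [map_sub, hR1, sub_zero]
    exact hF
  · rw [map_sub, ← hR, map_add]
    linear_combination hG
end
end

section
/- Let k be a field of characteristic p > 0 and K = k(x,y). Let m_x, m_y ∈ ℤ, set f = y^{m_y} and g = x^{m_x} (negative exponents denoting inverses in K), and n_x = m_x + 1, n_y = m_y + 1. Then f^p·∂_x^{p−1}(g) − g^p·∂_y^{p−1}(f) = (x·y)^{−p}·(ε_x·x^{n_x}·y^{p·n_y} − ε_y·x^{p·n_x}·y^{n_y}), where ε_x = −1 if p ∣ n_x and ε_x = 0 otherwise, and ε_y = −1 if p ∣ n_y and ε_y = 0 otherwise. -/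
open MvPolynomial

noncomputable section

/-- The iterated derivatives of an integer power of an element with derivative `1`. -/
theorem Derivation.iterate_zpow_of_apply_eq_one {k F : Type*} [Field k] [Field F] [Algebra k F]
    (D : Derivation k F F) {x : F} (hD : D x = 1) (m : ℤ) (n : ℕ) :
    (⇑D)^[n] (x ^ m) = (∏ i ∈ Finset.range n, ((m : F) - i)) * x ^ (m - n) := by
  have hpow (j : ℤ) : D (x ^ j) = (j : F) * x ^ (j - 1) := by
    rw [D.leibniz_zpow, hD]
    simp
  have hint (j : ℤ) : D (j : F) = 0 := D.map_intCast j
  induction n with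
  | zero => simp
  | succ n ih =>
    have hcoeff : (∏ i ∈ Finset.range n, ((m : F) - i))
        = ((∏ i ∈ Finset.range n, (m - i) : ℤ) : F) := by push_cast; rfl
    rw [Function.iterate_succ_apply', ih, Finset.prod_range_succ, hcoeff, D.leibniz, hint, hpow]
    rw [show m - ((n + 1 : ℕ) : ℤ) = m - n - 1 by push_cast; ring]
    simp only [smul_eq_mul, mul_zero, add_zero]
    push_cast
    ring

/-- In characteristic `p`, the product of the `p - 1` consecutive integers ending at `m` is `-1`
if `p ∣ m + 1` and `0` otherwise. -/
theorem CharP.prod_range_intCast_sub {F : Type*} [Field F] (p : ℕ) (hp : p.Prime) [CharP F p]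
    (m : ℤ) :
    (∏ i ∈ Finset.range (p - 1), ((m : F) - i)) = if (p : ℤ) ∣ m + 1 then -1 else 0 := by
  have : Fact p.Prime := ⟨hp⟩
  split_ifs with h
  · have hm : (m : F) = -1 := by
      have := (CharP.intCast_eq_zero_iff F p (m + 1)).2 h
      push_cast at this
      exact eq_neg_of_add_eq_zero_left this
    have hw : ((p - 1).factorial : F) = -1 := by
      have hcast := congrArg (ZMod.castHom dvd_rfl F) (ZMod.wilsons_lemma p)
      rwa [map_natCast, map_neg, map_one] at hcast
    have hsign : (-1 : F) ^ (p - 1) = 1 := by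
      have hchar : (-1 : F) ^ p = -1 := neg_one_pow_char F p
      rw [← Nat.sub_add_cancel hp.one_le, pow_succ] at hchar
      simpa using hchar
    calc (∏ i ∈ Finset.range (p - 1), ((m : F) - i))
        = ∏ i ∈ Finset.range (p - 1), (-1) * ((i + 1 : ℕ) : F) := by
          refine Finset.prod_congr rfl fun i _ => ?_
          rw [hm]; push_cast; ring
      _ = (-1) ^ (p - 1) * ((p - 1).factorial : F) := by
          rw [Finset.prod_mul_distrib, ← Nat.cast_prod, Finset.prod_range_add_one_eq_factorial]
          simp
      _ = -1 := by rw [hsign, hw, one_mul]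
  · have hp0 : (p : ℤ) ≠ 0 := by exact_mod_cast hp.ne_zero
    have hnonneg := Int.emod_nonneg m hp0
    have hlt := Int.emod_lt_of_pos m (by exact_mod_cast hp.pos : (0 : ℤ) < p)
    have hne : m % p ≠ p - 1 := fun he => h ⟨m / p + 1, by
      linear_combination -(Int.mul_ediv_add_emod m p) + he⟩
    refine Finset.prod_eq_zero (i := (m % p).toNat) (Finset.mem_range.2 (by omega)) ?_
    have hz := (CharP.intCast_eq_zero_iff F p (m - m % p)).2 (Int.dvd_self_sub_emod)
    have hcast : (((m % p).toNat : ℕ) : F) = ((m % p : ℤ) : F) := by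
      rw [← Int.cast_natCast, Int.toNat_of_nonneg hnonneg]
    rw [hcast]
    exact_mod_cast hz

/-- The computation in the proof of Corollary 4: for `f = y^{m_y}`, `g = x^{m_x}` in
`K = k(x,y)` (integer exponents), with `n_x = m_x + 1`, `n_y = m_y + 1`,
`f^p·∂_x^{p−1}(g) − g^p·∂_y^{p−1}(f)
  = (xy)^{−p}·(ε_x·x^{n_x}·y^{p·n_y} − ε_y·x^{p·n_x}·y^{n_y})`,
where `ε_x = −1` if `p ∣ n_x` and `0` otherwise, and similarly for `ε_y`. -/
theorem monomial_rhs_computation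
    (p : ℕ) (hp : p.Prime) (k : Type) [Field k] [CharP k p]
    (Dx Dy : Derivation k (RatFld2 k) (RatFld2 k))
    (hDxx : Dx (xK k) = 1) (hDxy : Dx (yK k) = 0)
    (hDyx : Dy (xK k) = 0) (hDyy : Dy (yK k) = 1)
    (mx my : ℤ) :
    (yK k ^ my) ^ p * (⇑Dx)^[p - 1] (xK k ^ mx)
        - (xK k ^ mx) ^ p * (⇑Dy)^[p - 1] (yK k ^ my)
      = (xK k * yK k) ^ (-(p : ℤ)) *
          ((if (p : ℤ) ∣ (mx + 1) then (-1 : RatFld2 k) else 0)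
              * xK k ^ (mx + 1) * yK k ^ ((p : ℤ) * (my + 1))
            - (if (p : ℤ) ∣ (my + 1) then (-1 : RatFld2 k) else 0)
              * xK k ^ ((p : ℤ) * (mx + 1)) * yK k ^ (my + 1)) := by
  have hx : xK k ≠ 0 := by simp
  have hy : yK k ≠ 0 := by simp
  have : CharP (RatFld2 k) p := charP_of_injective_algebraMap (algebraMap k (RatFld2 k)).injective p
  rw [Dx.iterate_zpow_of_apply_eq_one hDxx, Dy.iterate_zpow_of_apply_eq_one hDyy,
    CharP.prod_range_intCast_sub p hp, CharP.prod_range_intCast_sub p hp,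
    Nat.cast_sub hp.one_le, Nat.cast_one]
  have hexp (z w : RatFld2 k) (hz : z ≠ 0) (hw : w ≠ 0) (a b : ℤ) :
      (z * w) ^ (-(p : ℤ)) * (w ^ (a + 1) * z ^ ((p : ℤ) * (b + 1)))
        = (z ^ b) ^ p * w ^ (a - (p - 1)) := by
    rw [← zpow_natCast (z ^ b), ← zpow_mul, mul_zpow,
      show b * (p : ℤ) = -(p : ℤ) + p * (b + 1) by ring,
      show a - ((p : ℤ) - 1) = -p + (a + 1) by ring,
      zpow_add₀ hz (-p), zpow_add₀ hw (-p)]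
    ring
  have h1 := hexp _ _ hy hx mx my
  have h2 := hexp _ _ hx hy my mx
  rw [mul_comm (yK k) (xK k)] at h1
  linear_combination (-(if (p : ℤ) ∣ (mx + 1) then (-1 : RatFld2 k) else 0)) * h1
    + (if (p : ℤ) ∣ (my + 1) then (-1 : RatFld2 k) else 0) * h2
end
end
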